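/- arXiv:1903.07341 — 7 statements merged into one kernel-verified Lean document; each statement's English description precedes it below -/
import Mathlib

section
/- Let f = u + iv : ℂ → ℂ be a harmonic map such that the set D(R_f) of asymptotic directions of its range R_f = f(ℂ) contains no pair of antipodal points (i.e., there is no ζ on the unit circle with both ζ and −ζ in D(R_f)). Then f is constant. -/
open Complex Metric Filter Set

/-- A function `u : ℂ → ℝ` is harmonic on all of `ℂ` if it is `C²` and its Laplacian
(the sum of the second derivatives in the directions `1` and `I`) vanishes everywhere. -/
def HarmonicFn (u : ℂ → ℝ) : Prop :=
  ContDiff ℝ 2 u ∧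
    ∀ z : ℂ, iteratedFDeriv ℝ 2 u z ![1, 1] + iteratedFDeriv ℝ 2 u z ![Complex.I, Complex.I] = 0

/-- A function `u : ℂ → ℝ` is harmonic on a set `s` if it is `C²` on `s` and its Laplacian
vanishes on `s`. -/
def HarmonicOnSet (u : ℂ → ℝ) (s : Set ℂ) : Prop :=
  ContDiffOn ℝ 2 u s ∧
    ∀ z ∈ s, iteratedFDerivWithin ℝ 2 u s z ![1, 1]
      + iteratedFDerivWithin ℝ 2 u s z ![Complex.I, Complex.I] = 0

/-- The set of asymptotic directions of a set `R ⊆ ℂ`: points `ζ` of the unit circle for which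
there are `w n ∈ R` and positive `ε n → 0` with `ε n * w n → ζ`. -/
def asympDirs (R : Set ℂ) : Set ℂ :=
  {ζ : ℂ | ‖ζ‖ = 1 ∧ ∃ w : ℕ → ℂ, (∀ n, w n ∈ R) ∧ ∃ ε : ℕ → ℝ,
    (∀ n, 0 < ε n) ∧ Tendsto ε atTop (nhds 0) ∧
    Tendsto (fun n => (ε n : ℂ) * w n) atTop (nhds ζ)}

/-- `supOn u z r` is `M(u,z,r) = sup {u w : |w - z| ≤ r}`. -/
noncomputable def supOn (u : ℂ → ℝ) (z : ℂ) (r : ℝ) : ℝ :=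
  sSup (u '' Metric.closedBall z r)

/-- Subharmonic: upper semicontinuous and lies below every harmonic function dominating it on
the boundary of any disc. -/
def SubharmonicFn (w : ℂ → ℝ) : Prop :=
  UpperSemicontinuous w ∧
    ∀ (z₀ : ℂ) (r : ℝ), 0 < r → ∀ h : ℂ → ℝ,
      HarmonicOnSet h (Metric.ball z₀ r) → ContinuousOn h (Metric.closedBall z₀ r) →
      (∀ ζ ∈ Metric.sphere z₀ r, w ζ ≤ h ζ) → ∀ ζ ∈ Metric.closedBall z₀ r, w ζ ≤ h ζ

open InnerProductSpace Topology

theorem HarmonicFn.harmonicOnNhd {u : ℂ → ℝ} (hu : HarmonicFn u) :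
    HarmonicOnNhd u univ := by
  intro z _
  refine ⟨hu.1.contDiffAt, Eventually.of_forall fun x => ?_⟩
  simpa [laplacian_eq_iteratedFDeriv_complexPlane] using hu.2 x

/-- Lower Harnack inequality, comparing a point of a disc with its centre. -/
theorem InnerProductSpace.HarmonicOnNhd.harnack_le {L : ℂ → ℝ} {c w : ℂ} {R : ℝ}
    (hL : HarmonicOnNhd L (closedBall c R)) (hpos : ∀ z ∈ closedBall c R, 0 ≤ L z)
    (hw : w ∈ ball c R) :
    (R - ‖w - c‖) / (R + ‖w - c‖) * L c ≤ L w := by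
  have hR : 0 < R := pos_of_mem_ball hw
  have hL' : HarmonicOnNhd L (closedBall c |R|) := by rwa [abs_of_pos hR]
  have hcont : ContinuousOn L (sphere c R) := fun x hx =>
    (hL x (sphere_subset_closedBall hx)).1.continuousAt.continuousWithinAt
  have hker : ContinuousOn (re ∘ herglotzRieszKernel c w) (sphere c R) :=
    by
    have := continuousOn_herglotzRieszKernel_sphere hw
    rw [abs_of_pos hR] at this
    exact continuous_re.comp_continuousOn this
  rw [← hL'.circleAverage_eq, ← smul_eq_mul, ← Real.circleAverage_smul,
    ← hL.circleAverage_re_herglotzRieszKernel_smul hw]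
  refine Real.circleAverage_mono ?_ ?_ fun x hx => ?_
  · exact (continuousOn_const.smul hcont).circleIntegrable hR.le
  · exact (hker.smul hcont).circleIntegrable hR.le
  · rw [abs_of_pos hR] at hx
    exact mul_le_mul_of_nonneg_right (le_re_herglotzRieszKernel hx hw)
      (hpos x (sphere_subset_closedBall hx))

/-- If the asymptotic directions of `R` contain no antipodal pair, then the directions of any two
large elements of `R` are uniformly far from being antipodal. -/
theorem exists_gap_of_no_antipodal {R : Set ℂ}
    (h : ¬ ∃ ζ : ℂ, ζ ∈ asympDirs R ∧ -ζ ∈ asympDirs R) :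
    ∃ R₀ > 0, ∃ δ > 0, ∀ z ∈ R, ∀ w ∈ R, R₀ ≤ ‖z‖ → R₀ ≤ ‖w‖ →
      δ * (‖z‖ * ‖w‖) ≤ ‖(‖w‖ : ℂ) * z + (‖z‖ : ℂ) * w‖ := by
  contrapose! h
  have key : ∀ n : ℕ, ∃ z ∈ R, ∃ w ∈ R, (n + 1 : ℝ) ≤ ‖z‖ ∧ (n + 1 : ℝ) ≤ ‖w‖ ∧
      ‖(‖w‖ : ℂ) * z + (‖z‖ : ℂ) * w‖ < 1 / (n + 1 : ℝ) * (‖z‖ * ‖w‖) := by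
    intro n
    obtain ⟨z, hz, w, hw, h1, h2, h3⟩ := h (n + 1) (by positivity) (1 / (n + 1)) (by positivity)
    exact ⟨z, hz, w, hw, h1, h2, h3⟩
  choose z hz w hw hzn hwn hzw using key
  have hz0 n : 0 < ‖z n‖ := lt_of_lt_of_le (by positivity) (hzn n)
  have hw0 n : 0 < ‖w n‖ := lt_of_lt_of_le (by positivity) (hwn n)
  have hinv {x : ℕ → ℂ} (hx : ∀ n : ℕ, (n + 1 : ℝ) ≤ ‖x n‖) :
      Tendsto (fun n => ‖x n‖⁻¹) atTop (𝓝 0) :=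
    (tendsto_atTop_mono hx (tendsto_atTop_add_const_right _ _
      tendsto_natCast_atTop_atTop)).inv_tendsto_atTop
  obtain ⟨ζ, hζ, φ, hφ, hlim⟩ := (isCompact_sphere (0 : ℂ) 1).tendsto_subseq
    (x := fun n => ((‖z n‖⁻¹ : ℝ) : ℂ) * z n) (fun n => by simp [(hz0 n).ne'])
  have hsum : Tendsto (fun n => ((‖z n‖⁻¹ : ℝ) : ℂ) * z n + ((‖w n‖⁻¹ : ℝ) : ℂ) * w n)
      atTop (𝓝 0) := by
    refine squeeze_zero_norm (fun n => ?_) tendsto_one_div_add_atTop_nhds_zero_nat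
    have e : ((‖z n‖⁻¹ : ℝ) : ℂ) * z n + ((‖w n‖⁻¹ : ℝ) : ℂ) * w n
        = ((‖w n‖ : ℂ) * z n + (‖z n‖ : ℂ) * w n) / ((‖z n‖ * ‖w n‖ : ℝ) : ℂ) := by
      have h1 : (‖z n‖ : ℂ) ≠ 0 := by exact_mod_cast (hz0 n).ne'
      have h2 : (‖w n‖ : ℂ) ≠ 0 := by exact_mod_cast (hw0 n).ne'
      push_cast
      field_simp
    have hp := mul_pos (hz0 n) (hw0 n)
    rw [e, norm_div, norm_real, Real.norm_of_nonneg hp.le, div_le_iff₀ hp]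
    exact (hzw n).le
  have hζ1 : ‖ζ‖ = 1 := by simpa using hζ
  refine ⟨ζ, ⟨hζ1, z ∘ φ, fun n => hz _, fun n => ‖z (φ n)‖⁻¹, fun n => inv_pos.2 (hz0 _),
    (hinv hzn).comp hφ.tendsto_atTop, hlim⟩, ⟨by simpa using hζ1, w ∘ φ, fun n => hw _,
    fun n => ‖w (φ n)‖⁻¹, fun n => inv_pos.2 (hw0 _), (hinv hwn).comp hφ.tendsto_atTop, ?_⟩⟩
  simpa [Function.comp_def] using (hsum.comp hφ.tendsto_atTop).sub hlim

/-- A uniformly bounded sequence of entire functions has a subsequence converging uniformly on a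
smaller disc. -/
theorem exists_subseq_tendstoUniformlyOn_closedBall {E : Type*} [NormedAddCommGroup E]
    [NormedSpace ℂ E] [ProperSpace E] {Φ : ℕ → ℂ → E} (hd : ∀ n, Differentiable ℂ (Φ n))
    {r R B : ℝ} (hrR : r < R) (hB : ∀ n, ∀ z ∈ closedBall (0 : ℂ) R, ‖Φ n z‖ ≤ B) :
    ∃ (g : ℂ → E) (φ : ℕ → ℕ), StrictMono φ ∧
      TendstoUniformlyOn (fun n => Φ (φ n)) g atTop (closedBall 0 r) := by
  set K : Set ℂ := closedBall 0 r
  have hmem : ∀ z ∈ K, ∀ x ∈ closedBall z (R - r), x ∈ closedBall (0 : ℂ) R := fun z hz x hx => by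
    have h1 := dist_triangle x z 0
    rw [mem_closedBall] at *
    linarith [mem_closedBall.1 hz]
  have : CompactSpace K := isCompact_iff_compactSpace.1 (isCompact_closedBall _ _)
  have hderiv n : ∀ z ∈ K, ‖deriv (Φ n) z‖ ≤ B / (R - r) := fun z hz =>
    norm_deriv_le_of_forall_mem_sphere_norm_le (sub_pos.2 hrR) (hd n).diffContOnCl
      fun x hx => hB n x (hmem z hz x (sphere_subset_closedBall hx))
  have hlip n : ∀ x ∈ K, ∀ y ∈ K, ‖Φ n y - Φ n x‖ ≤ B / (R - r) * ‖y - x‖ := fun x hx y hy =>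
    (convex_closedBall (0 : ℂ) r).norm_image_sub_le_of_norm_deriv_le
      (fun z _ => (hd n) z) (hderiv n) hx hy
  let F : ℕ → BoundedContinuousFunction K E := fun n =>
    BoundedContinuousFunction.mkOfCompact
      ⟨fun x => Φ n x, (hd n).continuous.comp continuous_subtype_val⟩
  have hcomp : IsCompact (closure (range F)) := by
    refine BoundedContinuousFunction.arzela_ascoli (closedBall 0 B) (isCompact_closedBall _ _) _
      ?_ ?_
    · rintro _ x ⟨n, rfl⟩
      simpa [F] using hB n x (hmem x x.2 x (mem_closedBall_self (sub_nonneg.2 hrR.le)))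
    · refine Metric.equicontinuous_of_continuity_modulus (fun t => B / (R - r) * t) ?_ _ ?_
      · exact Continuous.tendsto' (by fun_prop) 0 0 (by simp)
      · rintro x y ⟨_, n, rfl⟩
        simpa [F, Subtype.dist_eq, dist_eq_norm] using hlip n y y.2 x x.2
  obtain ⟨g, -, φ, hφ, hlim⟩ := hcomp.tendsto_subseq (x := F) fun n => subset_closure ⟨n, rfl⟩
  rw [BoundedContinuousFunction.tendsto_iff_tendstoUniformly] at hlim
  classical
  refine ⟨fun z => if h : z ∈ K then g ⟨z, h⟩ else 0, φ, hφ, ?_⟩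
  rw [tendstoUniformlyOn_iff_tendstoUniformly_comp_coe]
  convert hlim using 1
  · exact funext fun _ => funext fun _ => rfl
  · exact funext fun x => dif_pos x.2

/-- `f` has a `δ`-gap beyond radius `R₀`: the directions of any two values of `f` of modulus at
least `R₀` are at distance at least `δ` from being antipodal. -/
def AntipodalGap (f : ℂ → ℂ) (R₀ δ : ℝ) : Prop :=
  ∀ z w, R₀ ≤ ‖f z‖ → R₀ ≤ ‖f w‖ →
    δ * (‖f z‖ * ‖f w‖) ≤ ‖(‖f w‖ : ℂ) * f z + (‖f z‖ : ℂ) * f w‖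

theorem Complex.norm_exp_mul_I_add_exp_mul_I (x y : ℝ) :
    ‖exp (x * I) + exp (y * I)‖ = 2 * |Real.cos ((x - y) / 2)| := by
  have e : exp (x * I) + exp (y * I)
      = exp (((x + y) / 2 : ℝ) * I) * (2 * Real.cos ((x - y) / 2) : ℝ) := by
    push_cast
    rw [two_cos, mul_add, ← exp_add, ← exp_add]
    congr 2 <;> ring
  rw [e, norm_mul, norm_exp_ofReal_mul_I, one_mul, norm_real, Real.norm_eq_abs, abs_mul, abs_two]

/-- Where `f` stays large, an antipodal gap yields a Harnack inequality for `‖f‖`. -/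
theorem AntipodalGap.harnack_le {f : ℂ → ℂ} {R₀ δ : ℝ} (hgap : AntipodalGap f R₀ δ)
    (hf : HarmonicOnNhd f univ) (hR₀ : 0 < R₀) (hδ : 0 < δ) {a b : ℂ} {R : ℝ}
    (hlarge : ∀ z ∈ closedBall a R, R₀ ≤ ‖f z‖) (hb : b ∈ ball a R) :
    (R - ‖b - a‖) / (R + ‖b - a‖) * (δ / 2) * ‖f a‖ ≤ ‖f b‖ := by
  have hR : 0 < R := pos_of_mem_ball hb
  have haR : a ∈ closedBall a R := mem_closedBall_self hR.le
  have hpos {z : ℂ} (hz : z ∈ closedBall a R) : 0 < ‖f z‖ := hR₀.trans_le (hlarge z hz)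
  have ha0 : f a ≠ 0 := norm_pos_iff.1 (hpos haR)
  set g : ℂ → ℂ := fun z => f z / f a with hg
  set θ : ℂ → ℝ := fun z => arg (g z) with hθ
  have hθa : θ a = 0 := by simp [hθ, hg]
  have hcos {z w : ℂ} (hz : z ∈ closedBall a R) (hw : w ∈ closedBall a R) :
      δ ≤ 2 * |Real.cos ((θ z - θ w) / 2)| := by
    have hpolar (z : ℂ) :
        f z = (‖f z‖ : ℂ) * exp (θ z * I) * (f a / (‖f a‖ : ℂ)) := by
      have h1 : (‖f a‖ : ℂ) ≠ 0 := by simpa using ha0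
      have h2 := norm_mul_exp_arg_mul_I (g z)
      rw [show ‖g z‖ = ‖f z‖ / ‖f a‖ from norm_div _ _] at h2
      calc f z = g z * f a := by simp [hg, ha0]
        _ = _ := by
          rw [← h2]
          push_cast
          field_simp
          rw [mul_comm I]
    have e : (‖f w‖ : ℂ) * f z + (‖f z‖ : ℂ) * f w
        = ((‖f z‖ * ‖f w‖ : ℝ) : ℂ) * (exp (θ z * I) + exp (θ w * I)) * (f a / (‖f a‖ : ℂ)) := by
      conv_lhs => rw [show (‖f w‖ : ℂ) * f z + (‖f z‖ : ℂ) * f w =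
        (‖f w‖ : ℂ) * ((‖f z‖ : ℂ) * exp (θ z * I) * (f a / (‖f a‖ : ℂ))) +
        (‖f z‖ : ℂ) * ((‖f w‖ : ℂ) * exp (θ w * I) * (f a / (‖f a‖ : ℂ))) by
          rw [← hpolar, ← hpolar]]
      push_cast
      ring
    have h := hgap z w (hlarge z hz) (hlarge w hw)
    have hp := mul_pos (hpos hz) (hpos hw)
    have h1 : ‖f a‖ ≠ 0 := (hpos haR).ne'
    rw [e, norm_mul, norm_mul, norm_real, Real.norm_of_nonneg hp.le, norm_exp_mul_I_add_exp_mul_I,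
      norm_div, norm_real, norm_norm, div_self h1, mul_one, mul_comm δ] at h
    exact le_of_mul_le_mul_left h hp
  have hne_pi {z w : ℂ} (hz : z ∈ closedBall a R) (hw : w ∈ closedBall a R) :
      θ z - θ w ≠ Real.pi := fun h => by
    have := hcos hz hw
    rw [h] at this
    simp at this
    linarith
  have hfc : ContinuousOn f (closedBall a R) := fun x _ =>
    (hf x (mem_univ x)).1.continuousAt.continuousWithinAt
  have hθc : ContinuousOn θ (closedBall a R) := by
    refine fun z hz => ContinuousAt.comp_continuousWithinAt (f := g) (g := arg) ?_
      ((hfc.div_const _) z hz)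
    refine continuousAt_arg (mem_slitPlane_iff_arg.2 ⟨fun h => ?_, ?_⟩)
    · exact hne_pi hz haR (by rw [hθa, sub_zero]; exact h)
    · exact div_ne_zero (norm_pos_iff.1 (hpos hz)) ha0
  obtain ⟨p, hp, hpmin⟩ := (isCompact_closedBall a R).exists_isMinOn ⟨a, haR⟩ hθc
  obtain ⟨q, hq, hqmax⟩ := (isCompact_closedBall a R).exists_isMaxOn ⟨a, haR⟩ hθc
  have hpq : θ p ≤ θ q := hpmin hq
  have hlt : θ q - θ p < Real.pi := by
    by_contra! h
    obtain ⟨z, hz, hzθ⟩ := (convex_closedBall a R).isPreconnected.intermediate_value hp hq hθc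
      (show θ p + Real.pi ∈ Icc (θ p) (θ q) from ⟨by linarith [Real.pi_pos], by linarith⟩)
    exact hne_pi hz hp (by rw [hzθ]; ring)
  set α : ℝ := (θ p + θ q) / 2 with hα
  have hcosβ : δ / 2 ≤ Real.cos ((θ q - θ p) / 2) := by
    have h := hcos hq hp
    rw [abs_of_nonneg (Real.cos_nonneg_of_mem_Icc ⟨by linarith [Real.pi_pos], by linarith⟩)] at h
    linarith
  have hcosα {z : ℂ} (hz : z ∈ closedBall a R) : δ / 2 ≤ Real.cos (θ z - α) := by
    have h1 : θ p ≤ θ z := hpmin hz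
    have h2 : θ z ≤ θ q := hqmax hz
    rw [← Real.cos_abs]
    refine hcosβ.trans (Real.cos_le_cos_of_nonneg_of_le_pi (abs_nonneg _) (by linarith) ?_)
    rw [abs_le]
    constructor <;> rw [hα] <;> linarith
  set κ : ℂ := exp (-α * I) / f a with hκ
  set L : ℂ → ℝ := fun z => (κ * f z).re with hLdef
  have hL : HarmonicOnNhd L univ :=
    hf.comp_CLM (reCLM.comp ((ContinuousLinearMap.mul ℝ ℂ) κ))
  have hLval (z : ℂ) : L z = ‖g z‖ * Real.cos (θ z - α) := by
    have e : κ * f z = ((‖g z‖ : ℝ) : ℂ) * exp ((θ z - α : ℝ) * I) := by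
      calc κ * f z = exp (-α * I) * g z := by rw [hκ, hg]; ring
        _ = exp (-α * I) * (‖g z‖ * exp (arg (g z) * I)) := by rw [norm_mul_exp_arg_mul_I]
        _ = ‖g z‖ * (exp (-α * I) * exp (θ z * I)) := by ring
        _ = _ := by
          rw [← exp_add]
          push_cast
          congr 2
          ring
    rw [hLdef]
    simp only [e, re_ofReal_mul, exp_ofReal_mul_I_re]
  have hH := (hL.mono (subset_univ (closedBall a R))).harnack_le (fun z hz => by
    rw [hLval]
    exact mul_nonneg (norm_nonneg _) ((half_pos hδ).le.trans (hcosα hz))) hb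
  have hga : ‖g a‖ = 1 := by simp [hg, ha0]
  have hLa : δ / 2 ≤ L a := by simpa [hLval, hga] using hcosα haR
  have hLb : L b ≤ ‖f b‖ / ‖f a‖ := by
    rw [hLval, ← norm_div]
    exact mul_le_of_le_one_right (norm_nonneg _) (Real.cos_le_one _)
  have hk : 0 ≤ (R - ‖b - a‖) / (R + ‖b - a‖) := by
    have := mem_ball_iff_norm.1 hb
    exact div_nonneg (by linarith) (by positivity)
  rw [← le_div_iff₀ (hpos haR)]
  exact ((mul_le_mul_of_nonneg_left hLa hk).trans hH).trans hLb

theorem AntipodalGap.exists_norm_le_mul {f : ℂ → ℂ} {R₀ δ : ℝ} (hgap : AntipodalGap f R₀ δ)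
    (hf : HarmonicOnNhd f univ) (hR₀ : 0 < R₀) (hδ : 0 < δ) :
    ∃ K, 1 ≤ K ∧ ∀ a d, 0 < d → (∀ z ∈ ball a d, R₀ < ‖f z‖) →
      ∀ b, dist b a ≤ 3 / 4 * d → ‖f a‖ ≤ K * ‖f b‖ := by
  refine ⟨26 / δ + 1, by linarith [div_pos (by norm_num : (0 : ℝ) < 26) hδ],
    fun a d hd hlarge b hb => ?_⟩
  have h := hgap.harnack_le hf hR₀ hδ (a := a) (b := b) (R := 7 / 8 * d)
    (fun z hz => (hlarge z (by rw [mem_closedBall] at hz; rw [mem_ball]; linarith)).le)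
    (by rw [mem_ball]; linarith)
  rw [dist_eq_norm] at hb
  have hk : 1 / 13 ≤ (7 / 8 * d - ‖b - a‖) / (7 / 8 * d + ‖b - a‖) := by
    rw [div_le_div_iff₀ (by norm_num) (by positivity)]
    linarith
  have h2 : 1 / 13 * (δ / 2) * ‖f a‖ ≤ ‖f b‖ := le_trans (by gcongr) h
  have h3 : ‖f a‖ ≤ 26 / δ * ‖f b‖ := by
    rw [div_mul_eq_mul_div, le_div_iff₀ hδ]
    linarith
  linarith [norm_nonneg (f b)]

/-- A Rickman-type selection: an unbounded function obeying Harnack's inequality off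
`{‖f‖ ≤ R₀}` has doubling discs centred on that set on which it is arbitrarily large. -/
theorem exists_doubling_disc {f : ℂ → ℂ} (hf : Continuous f) {R₀ K : ℝ} (hK : 1 ≤ K)
    (hH : ∀ a d, 0 < d → (∀ z ∈ ball a d, R₀ < ‖f z‖) →
      ∀ b, dist b a ≤ 3 / 4 * d → ‖f a‖ ≤ K * ‖f b‖)
    (hne : ∃ z, ‖f z‖ ≤ R₀) (hunb : ∀ N : ℝ, ∃ p, N ≤ ‖f p‖) (N : ℝ) :
    ∃ z r p, ‖f z‖ ≤ R₀ ∧ 0 < r ∧ dist p z ≤ r ∧ N ≤ ‖f p‖ ∧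
      ∀ q, dist q z ≤ 2 * r → ‖f q‖ ≤ 2 * K * ‖f p‖ := by
  wlog hN : max 1 (R₀ + 1) ≤ N generalizing N
  · obtain ⟨z, r, p, h1, h2, h3, h4, h5⟩ := this _ (le_max_right N _)
    exact ⟨z, r, p, h1, h2, h3, (le_max_left _ _).trans h4, h5⟩
  have hN1 : 1 ≤ N := (le_max_left _ _).trans hN
  have hNR : R₀ + 1 ≤ N := (le_max_right _ _).trans hN
  by_contra! hcon
  have hclosed : IsClosed {z | ‖f z‖ ≤ R₀} := isClosed_le hf.norm continuous_const
  have step : ∀ z r p, ‖f z‖ ≤ R₀ → 0 < r → dist p z ≤ r → N ≤ ‖f p‖ →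
      ∃ z' p', ‖f z'‖ ≤ R₀ ∧ dist p' z' ≤ r / 2 ∧ 2 * ‖f p‖ ≤ ‖f p'‖ ∧ dist z' z ≤ 4 * r := by
    intro z r p hz hr hp hNp
    obtain ⟨a, ha, hpa⟩ := hcon z r p hz hr hp hNp
    have hfa : R₀ < ‖f a‖ := by nlinarith
    obtain ⟨z', hz', hd⟩ := hclosed.exists_infDist_eq_dist ⟨z, hz⟩ a
    have hle : dist a z' ≤ 2 * r := by
      rw [← hd]
      exact (infDist_le_dist_of_mem (s := {z | ‖f z‖ ≤ R₀}) hz).trans ha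
    have hdpos : 0 < dist a z' := dist_pos.2 fun h => by
      rw [h] at hfa
      exact absurd hz' (not_le.2 hfa)
    set b : ℂ := z' + (1 / 4 : ℝ) * (a - z') with hb
    have hbz : dist b z' = 1 / 4 * dist a z' := by
      rw [dist_eq_norm, dist_eq_norm, hb, add_sub_cancel_left, norm_mul, norm_real]
      norm_num
    have hba : dist b a = 3 / 4 * dist a z' := by
      rw [dist_eq_norm, dist_eq_norm,
        show b - a = ((-(3 / 4) : ℝ) : ℂ) * (a - z') by rw [hb]; push_cast; ring, norm_mul,
        norm_real]
      norm_num
    have hab := hH a _ hdpos (fun x hx => by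
      by_contra! h
      have h1 := infDist_le_dist_of_mem (x := a) (show x ∈ {z | ‖f z‖ ≤ R₀} from h)
      rw [mem_ball, dist_comm] at hx
      linarith) b hba.le
    refine ⟨z', b, hz', by rw [hbz]; linarith, ?_, ?_⟩
    · have : K * (2 * ‖f p‖) ≤ K * ‖f b‖ := by linarith
      exact le_of_mul_le_mul_left this (by linarith)
    · have := dist_triangle z' a z
      rw [dist_comm z' a] at this
      linarith
  obtain ⟨z₀, hz₀⟩ := hne
  obtain ⟨p₀, hp₀⟩ := hunb N
  set r₀ := dist p₀ z₀ with hr₀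
  have hr₀pos : 0 < r₀ := dist_pos.2 fun h => by
    rw [h] at hp₀
    linarith
  have iter : ∀ n : ℕ, ∃ z p, ‖f z‖ ≤ R₀ ∧ dist p z ≤ r₀ / 2 ^ n ∧ 2 ^ n * N ≤ ‖f p‖ ∧
      dist z z₀ ≤ 8 * r₀ - 8 * (r₀ / 2 ^ n) := by
    intro n
    induction n with
    | zero => exact ⟨z₀, p₀, hz₀, by simp [hr₀], by simpa using hp₀, by simp⟩
    | succ n ih =>
      obtain ⟨z, p, h1, h2, h3, h4⟩ := ih
      have h2n : (1 : ℝ) ≤ 2 ^ n := one_le_pow₀ (by norm_num)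
      obtain ⟨z', p', h1', h2', h3', h4'⟩ := step z (r₀ / 2 ^ n) p h1 (by positivity) h2
        (by nlinarith)
      have e : r₀ / 2 ^ (n + 1) = r₀ / 2 ^ n / 2 := by rw [pow_succ, div_div]
      refine ⟨z', p', h1', by rwa [e], ?_, ?_⟩
      · rw [pow_succ]
        linarith
      · rw [e]
        linarith [dist_triangle z' z z₀]
  obtain ⟨B, hB⟩ := (isCompact_closedBall z₀ (9 * r₀)).exists_bound_of_continuousOn hf.continuousOn
  obtain ⟨n, hn⟩ := pow_unbounded_of_one_lt B (by norm_num : (1 : ℝ) < 2)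
  obtain ⟨z, p, -, h2, h3, h4⟩ := iter n
  have h2n : (1 : ℝ) ≤ 2 ^ n := one_le_pow₀ (by norm_num)
  have hle : r₀ / 2 ^ n ≤ r₀ := div_le_self hr₀pos.le h2n
  have hpos : 0 < r₀ / 2 ^ n := by positivity
  have := hB p (by
    rw [mem_closedBall]
    linarith [dist_triangle p z z₀])
  nlinarith

/-- The harmonic map whose coordinates are the real parts of those of a pair. -/
noncomputable def realParts (p : ℂ × ℂ) : ℂ := p.1.re + p.2.re * I

theorem continuous_realParts : Continuous realParts := by
  unfold realParts
  fun_prop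

theorem realParts_real_smul (t : ℝ) (p : ℂ × ℂ) : realParts (t • p) = t * realParts p := by
  simp only [realParts, Prod.smul_fst, Prod.smul_snd, real_smul, re_ofReal_mul]
  push_cast
  ring

theorem realParts_neg (p : ℂ × ℂ) : realParts (-p) = -realParts p := by
  simp [realParts]
  ring

theorem norm_realParts_le (p : ℂ × ℂ) : ‖realParts p‖ ≤ 2 * ‖p‖ := by
  calc ‖realParts p‖ ≤ ‖(p.1.re : ℂ)‖ + ‖(p.2.re : ℂ) * I‖ := norm_add_le _ _
    _ = |p.1.re| + |p.2.re| := by simp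
    _ ≤ ‖p.1‖ + ‖p.2‖ := add_le_add (abs_re_le_norm _) (abs_re_le_norm _)
    _ ≤ 2 * ‖p‖ := by linarith [norm_fst_le p, norm_snd_le p]

theorem abs_re_fst_le_norm_realParts (p : ℂ × ℂ) : |p.1.re| ≤ ‖realParts p‖ := by
  simpa [realParts] using abs_re_le_norm (realParts p)

theorem abs_re_snd_le_norm_realParts (p : ℂ × ℂ) : |p.2.re| ≤ ‖realParts p‖ := by
  simpa [realParts] using abs_im_le_norm (realParts p)

theorem exists_realParts_smul_ne_zero {p : ℂ × ℂ} (hp : p ≠ 0) :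
    ∃ w : ℂ, realParts (w • p) ≠ 0 := by
  by_contra! h
  refine hp (Prod.ext ?_ ?_)
  · have := abs_re_fst_le_norm_realParts ((starRingEnd ℂ p.1) • p)
    rw [h, norm_zero, Prod.smul_fst, smul_eq_mul, ← normSq_eq_conj_mul_self, ofReal_re] at this
    exact normSq_eq_zero.1 (abs_nonpos_iff.1 this)
  · have := abs_re_snd_le_norm_realParts ((starRingEnd ℂ p.2) • p)
    rw [h, norm_zero, Prod.smul_snd, smul_eq_mul, ← normSq_eq_conj_mul_self, ofReal_re] at this
    exact normSq_eq_zero.1 (abs_nonpos_iff.1 this)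

/-- The leading homogeneous part of a harmonic map at a zero takes antipodal values, so a harmonic
map with an antipodal gap at every scale vanishes near its zeros. -/
theorem eventually_eq_zero_of_gap {Φ : ℂ → ℂ × ℂ} (hΦ : AnalyticAt ℂ Φ 0) (h0 : Φ 0 = 0)
    {U : Set ℂ} (hU : U ∈ 𝓝 0) {δ : ℝ} (hδ : 0 < δ)
    (hgap : ∀ z ∈ U, ∀ w ∈ U, δ * (‖realParts (Φ z)‖ * ‖realParts (Φ w)‖) ≤
      ‖(‖realParts (Φ w)‖ : ℂ) * realParts (Φ z) + (‖realParts (Φ z)‖ : ℂ) * realParts (Φ w)‖) :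
    ∀ᶠ z in 𝓝 0, Φ z = 0 := by
  by_contra hne
  obtain ⟨n, g, hg, hg0, hgΦ⟩ := hΦ.exists_eventuallyEq_pow_smul_nonzero_iff.2 hne
  simp only [sub_zero] at hgΦ
  have hn : n ≠ 0 := by
    rintro rfl
    have := hgΦ.self_of_nhds
    rw [h0, pow_zero, one_smul] at this
    exact hg0 this.symm
  obtain ⟨w, hw⟩ := exists_realParts_smul_ne_zero hg0
  obtain ⟨ω, hω⟩ := IsAlgClosed.exists_pow_nat_eq w (Nat.pos_of_ne_zero hn)
  obtain ⟨ω', hω'⟩ := IsAlgClosed.exists_pow_nat_eq (-w) (Nat.pos_of_ne_zero hn)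
  set c := realParts (w • g 0) with hc
  have htend (ν : ℂ) : Tendsto (fun t : ℝ => (t : ℂ) * ν) (𝓝[>] 0) (𝓝 0) :=
    (Continuous.tendsto' (by fun_prop) 0 0 (by simp)).mono_left nhdsWithin_le_nhds
  have hlim (ν : ℂ) : Tendsto (fun t : ℝ => realParts (ν ^ n • g (t * ν))) (𝓝[>] 0)
      (𝓝 (realParts (ν ^ n • g 0))) :=
    (continuous_realParts.tendsto _).comp ((hg.continuousAt.tendsto.comp (htend ν)).const_smul _)
  have hval (ν : ℂ) : ∀ᶠ t : ℝ in 𝓝[>] 0,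
      realParts (Φ (t * ν)) = (t ^ n : ℝ) * realParts (ν ^ n • g (t * ν)) := by
    filter_upwards [(htend ν).eventually hgΦ] with t ht
    rw [ht, ← realParts_real_smul, mul_pow, mul_smul]
    congr 1
    rw [← ofReal_pow]
    rfl
  have ha := hlim ω
  have hb := hlim ω'
  rw [hω, ← hc] at ha
  rw [hω', neg_smul, realParts_neg, ← hc] at hb
  have hev : ∀ᶠ t : ℝ in 𝓝[>] 0,
      δ * (‖realParts (w • g (t * ω))‖ * ‖realParts ((-w) • g (t * ω'))‖) ≤
      ‖(‖realParts ((-w) • g (t * ω'))‖ : ℂ) * realParts (w • g (t * ω)) +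
        (‖realParts (w • g (t * ω))‖ : ℂ) * realParts ((-w) • g (t * ω'))‖ := by
    filter_upwards [hval ω, hval ω', (htend ω).eventually hU, (htend ω').eventually hU,
      self_mem_nhdsWithin] with t h1 h2 h3 h4 ht
    have h := hgap _ h3 _ h4
    rw [h1, h2, hω, hω'] at h
    set a := realParts (w • g (t * ω))
    set b := realParts ((-w) • g (t * ω'))
    have htn : 0 < t ^ n := pow_pos ht n
    rw [norm_mul, norm_mul, norm_real, Real.norm_of_nonneg htn.le,
      show ((t ^ n * ‖b‖ : ℝ) : ℂ) * ((t ^ n : ℝ) * a) + ((t ^ n * ‖a‖ : ℝ) : ℂ) * ((t ^ n : ℝ) * b)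
        = ((t ^ n * t ^ n : ℝ) : ℂ) * (‖b‖ * a + ‖a‖ * b) by push_cast; ring, norm_mul,
      norm_real, Real.norm_of_nonneg (by positivity),
      show δ * (t ^ n * ‖a‖ * (t ^ n * ‖b‖)) = t ^ n * t ^ n * (δ * (‖a‖ * ‖b‖)) by ring] at h
    exact le_of_mul_le_mul_left h (by positivity)
  have hfin := le_of_tendsto_of_tendsto ((ha.norm.mul hb.norm).const_mul δ)
    ((((continuous_ofReal.tendsto _).comp hb.norm).mul ha).add
      (((continuous_ofReal.tendsto _).comp ha.norm).mul hb)).norm hev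
  rw [norm_neg, mul_neg, add_neg_cancel, norm_zero] at hfin
  have : 0 < ‖c‖ := norm_pos_iff.2 hw
  have : 0 < δ * (‖c‖ * ‖c‖) := by positivity
  linarith

theorem norm_le_of_abs_re_le {H : ℂ → ℂ} (hH : Differentiable ℂ H) {C : ℝ} (hC : 0 < C)
    (h0 : (H 0).im = 0) (hre : ∀ z ∈ closedBall (0 : ℂ) 2, |(H z).re| ≤ C) :
    ∀ z ∈ closedBall (0 : ℂ) (7 / 4), ‖H z‖ ≤ 29 * C := by
  intro z hz
  have hz' : ‖z‖ ≤ 7 / 4 := mem_closedBall_zero_iff.1 hz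
  have h00 : ‖H 0‖ ≤ C := by
    rw [← re_add_im (H 0), h0]
    simpa using hre 0 (by simp)
  have h := borelCaratheodory (R := 2) hC hH.differentiableOn
    (fun x hx => (le_abs_self _).trans (hre x (ball_subset_closedBall hx))) (by norm_num)
    (mem_ball_zero_iff.2 (by linarith)) (z := z)
  refine h.trans ?_
  have hd : 0 < 2 - ‖z‖ := by linarith
  rw [← add_div, div_le_iff₀ hd]
  nlinarith [norm_nonneg z]

/-- There is no sequence of normalised harmonic maps, bounded on a disc, whose values at the origin
tend to `0` and whose antipodal gaps hold beyond radii tending to `0`. -/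
theorem not_exists_blowup {Φ : ℕ → ℂ → ℂ × ℂ} (hΦ : ∀ n, Differentiable ℂ (Φ n)) {B δ : ℝ}
    (hδ : 0 < δ) (hB : ∀ n, ∀ z ∈ closedBall (0 : ℂ) (7 / 4), ‖Φ n z‖ ≤ B)
    (h0 : Tendsto (fun n => Φ n 0) atTop (𝓝 0)) {ρ : ℕ → ℝ} (hρ : Tendsto ρ atTop (𝓝 0))
    (hgap : ∀ n, AntipodalGap (fun z => realParts (Φ n z)) (ρ n) δ)
    (hone : ∀ n, ∃ x ∈ closedBall (0 : ℂ) 1, ‖realParts (Φ n x)‖ = 1) : False := by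
  obtain ⟨g, φ, hφ, hlim⟩ := exists_subseq_tendstoUniformlyOn_closedBall hΦ
    (r := 3 / 2) (by norm_num) hB
  set U : Set ℂ := ball 0 (3 / 2)
  have hUK : U ⊆ closedBall 0 (3 / 2) := ball_subset_closedBall
  have h0U : (0 : ℂ) ∈ U := mem_ball_self (by norm_num)
  have hgd : DifferentiableOn ℂ g U :=
    (hlim.mono hUK).tendstoLocallyUniformlyOn.differentiableOn
      (Eventually.of_forall fun n => (hΦ _).differentiableOn) isOpen_ball
  have hga : AnalyticOnNhd ℂ g U := hgd.analyticOnNhd isOpen_ball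
  have hpt {z : ℂ} (hz : z ∈ U) :
      Tendsto (fun n => realParts (Φ (φ n) z)) atTop (𝓝 (realParts (g z))) :=
    (continuous_realParts.tendsto _).comp (hlim.tendsto_at (hUK hz))
  have hg0 : g 0 = 0 :=
    tendsto_nhds_unique (hlim.tendsto_at (hUK h0U)) (h0.comp hφ.tendsto_atTop)
  have hlarge {z : ℂ} (hz : z ∈ U) (h : realParts (g z) ≠ 0) :
      ∀ᶠ n in atTop, ρ (φ n) ≤ ‖realParts (Φ (φ n) z)‖ :=
    (((hρ.comp hφ.tendsto_atTop).eventually_lt (hpt hz).norm (norm_pos_iff.2 h))).mono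
      fun _ => le_of_lt
  have hzero : ∀ᶠ z in 𝓝 0, g z = 0 := by
    refine eventually_eq_zero_of_gap (hga 0 h0U) hg0 (isOpen_ball.mem_nhds h0U) hδ
      fun z hz w hw => ?_
    by_cases hz0 : realParts (g z) = 0
    · simp [hz0]
    by_cases hw0 : realParts (g w) = 0
    · simp [hw0]
    refine le_of_tendsto_of_tendsto (((hpt hz).norm.mul (hpt hw).norm).const_mul δ)
      ((((continuous_ofReal.tendsto _).comp (hpt hw).norm).mul (hpt hz)).add
        (((continuous_ofReal.tendsto _).comp (hpt hz).norm).mul (hpt hw))).norm ?_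
    filter_upwards [hlarge hz hz0, hlarge hw hw0] with n h1 h2 using hgap (φ n) z w h1 h2
  have hgU : EqOn g 0 U := hga.eqOn_zero_of_preconnected_of_eventuallyEq_zero
    (convex_ball _ _).isPreconnected h0U hzero
  obtain ⟨n, hn⟩ := (Metric.tendstoUniformlyOn_iff.1 hlim (1 / 2) (by norm_num)).exists
  obtain ⟨x, hx, hx1⟩ := hone (φ n)
  have hxU : x ∈ U := closedBall_subset_ball (by norm_num) hx
  have h := hn x (hUK hxU)
  rw [hgU hxU, Pi.zero_apply, dist_zero_left] at h
  linarith [norm_realParts_le (Φ (φ n) x)]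

/-- A harmonic map of the plane with an antipodal gap is bounded. -/
theorem AntipodalGap.bddAbove_norm {F G : ℂ → ℂ} (hF : Differentiable ℂ F)
    (hG : Differentiable ℂ G) {f : ℂ → ℂ} (hfFG : ∀ z, f z = realParts (F z, G z))
    (hf : HarmonicOnNhd f univ) {R₀ δ : ℝ} (hgap : AntipodalGap f R₀ δ) (hR₀ : 0 < R₀)
    (hδ : 0 < δ) : ∃ B, ∀ z, ‖f z‖ ≤ B := by
  obtain ⟨K, hK, hH⟩ := hgap.exists_norm_le_mul hf hR₀ hδ
  by_cases hne : ∃ z, ‖f z‖ ≤ R₀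
  swap
  · push Not at hne
    refine ⟨K * ‖f 0‖, fun z => hH z (4 / 3 * (‖z‖ + 1)) (by positivity) (fun x _ => hne x) 0 ?_⟩
    rw [dist_zero_left]
    linarith
  by_contra! hunb
  have hfc : Continuous f := continuous_iff_continuousAt.2 fun x =>
    (hf x (mem_univ x)).1.continuousAt
  have hsel : ∀ n : ℕ, _ := fun n => exists_doubling_disc hfc hK hH hne
    (fun N => (hunb N).imp fun _ h => h.le) ((n : ℝ) + 1)
  choose z r p hz hr hp hN hdbl using hsel
  have hm n : 0 < ‖f (p n)‖ := lt_of_lt_of_le (by positivity) (hN n)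
  set Φ : ℕ → ℂ → ℂ × ℂ := fun n x => (‖f (p n)‖⁻¹ : ℝ) •
    (F (z n + r n * x) - (F (z n)).im * I, G (z n + r n * x) - (G (z n)).im * I) with hΦ
  have hΦf n x : realParts (Φ n x) = (‖f (p n)‖⁻¹ : ℝ) * f (z n + r n * x) := by
    rw [hΦ, realParts_real_smul, hfFG (z n + r n * x)]
    congr 1
    simp [realParts]
  have hΦnorm n x : ‖realParts (Φ n x)‖ = ‖f (p n)‖⁻¹ * ‖f (z n + r n * x)‖ := by
    rw [hΦf, norm_mul, norm_real, Real.norm_of_nonneg (inv_nonneg.2 (hm n).le)]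
  have hd1 n : Differentiable ℂ fun x => (Φ n x).1 := by
    simp only [hΦ, Prod.smul_fst]
    fun_prop
  have hd2 n : Differentiable ℂ fun x => (Φ n x).2 := by
    simp only [hΦ, Prod.smul_snd]
    fun_prop
  have hbd n : ∀ x ∈ closedBall (0 : ℂ) 2, ‖realParts (Φ n x)‖ ≤ 2 * K := by
    intro x hx
    rw [hΦnorm, inv_mul_le_iff₀ (hm n), mul_comm ‖f (p n)‖]
    refine hdbl n _ ?_
    rw [dist_eq_norm, add_sub_cancel_left, norm_mul, norm_real, Real.norm_of_nonneg (hr n).le,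
      mul_comm]
    exact mul_le_mul_of_nonneg_right (mem_closedBall_zero_iff.1 hx) (hr n).le
  have him1 n : (Φ n 0).1.im = 0 := by simp [hΦ]
  have him2 n : (Φ n 0).2.im = 0 := by simp [hΦ]
  have hsmall n : ‖realParts (Φ n 0)‖ ≤ R₀ / (n + 1) := by
    rw [hΦnorm, mul_zero, add_zero, inv_mul_eq_div]
    gcongr
    · exact hz n
    · exact hN n
  have hR₀lim : Tendsto (fun n : ℕ => R₀ / ((n : ℝ) + 1)) atTop (𝓝 0) := by
    simpa [div_eq_mul_inv] using tendsto_one_div_add_atTop_nhds_zero_nat.const_mul R₀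
  refine not_exists_blowup (Φ := Φ) (B := 29 * (2 * K)) (ρ := fun n => R₀ / (n + 1))
    (fun n => (hd1 n).prodMk (hd2 n)) hδ (fun n x hx => ?_) ?_ hR₀lim (fun n x y hx hy => ?_)
    fun n => ⟨(p n - z n) / r n, ?_, ?_⟩
  · rw [Prod.norm_def]
    exact max_le
      (norm_le_of_abs_re_le (hd1 n) (by linarith) (him1 n)
        (fun y hy => (abs_re_fst_le_norm_realParts _).trans (hbd n y hy)) x hx)
      (norm_le_of_abs_re_le (hd2 n) (by linarith) (him2 n)
        (fun y hy => (abs_re_snd_le_norm_realParts _).trans (hbd n y hy)) x hx)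
  · refine squeeze_zero_norm (fun n => ?_) hR₀lim
    rw [Prod.norm_def]
    refine max_le ?_ ?_
    · rw [← abs_re_eq_norm.2 (him1 n)]
      exact (abs_re_fst_le_norm_realParts _).trans (hsmall n)
    · rw [← abs_re_eq_norm.2 (him2 n)]
      exact (abs_re_snd_le_norm_realParts _).trans (hsmall n)
  · have hi : 0 < ‖f (p n)‖⁻¹ := inv_pos.2 (hm n)
    have hlarge {x : ℂ} (hx : R₀ / (n + 1) ≤ ‖realParts (Φ n x)‖) :
        R₀ ≤ ‖f (z n + r n * x)‖ := by
      rw [hΦnorm, div_le_iff₀ (by positivity)] at hx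
      refine hx.trans ?_
      rw [mul_right_comm]
      refine mul_le_of_le_one_left (norm_nonneg _) ?_
      rw [inv_mul_le_iff₀ (hm n), mul_one]
      exact hN n
    have h := hgap _ _ (hlarge hx) (hlarge hy)
    simp only [hΦnorm]
    rw [hΦf, hΦf]
    set a := f (z n + r n * x)
    set b := f (z n + r n * y)
    set i := ‖f (p n)‖⁻¹
    rw [show ((i * ‖b‖ : ℝ) : ℂ) * (i * a) + ((i * ‖a‖ : ℝ) : ℂ) * (i * b)
        = ((i * i : ℝ) : ℂ) * (‖b‖ * a + ‖a‖ * b) by push_cast; ring, norm_mul,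
      norm_real, Real.norm_of_nonneg (by positivity),
      show δ * (i * ‖a‖ * (i * ‖b‖)) = i * i * (δ * (‖a‖ * ‖b‖)) by ring]
    exact mul_le_mul_of_nonneg_left h (by positivity)
  · rw [mem_closedBall_zero_iff, norm_div, norm_real, Real.norm_of_nonneg (hr n).le,
      div_le_one (hr n), ← dist_eq_norm]
    exact hp n
  · have hr0 : (r n : ℂ) ≠ 0 := by exact_mod_cast (hr n).ne'
    rw [hΦnorm, mul_div_cancel₀ _ hr0, add_sub_cancel, inv_mul_cancel₀ (hm n).ne']

/-- **Theorem 1.** If `f = u + iv` is a harmonic map whose set of asymptotic directions of the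
range contains no pair of antipodal points, then `f` is constant. -/
theorem range_no_antipodal_implies_constant
    (u v : ℂ → ℝ) (hu : HarmonicFn u) (hv : HarmonicFn v)
    (f : ℂ → ℂ) (hf : ∀ z, f z = (u z : ℂ) + (v z : ℂ) * Complex.I)
    (hno : ¬ ∃ ζ : ℂ, ζ ∈ asympDirs (Set.range f) ∧ -ζ ∈ asympDirs (Set.range f)) :
    ∃ c : ℂ, ∀ z, f z = c := by
  obtain ⟨F, hF, hFu⟩ := hu.harmonicOnNhd.exists_analyticOnNhd_univ_re_eq
  obtain ⟨G, hG, hGv⟩ := hv.harmonicOnNhd.exists_analyticOnNhd_univ_re_eq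
  have hfFG : ∀ z, f z = realParts (F z, G z) := fun z => by
    rw [hf, ← hFu, ← hGv, realParts]
  have hharm : HarmonicOnNhd f univ := by
    rw [funext hf]
    exact (hu.harmonicOnNhd.comp_CLM ofRealCLM).add
      (hv.harmonicOnNhd.comp_CLM (((ContinuousLinearMap.mul ℝ ℂ).flip I).comp ofRealCLM))
  obtain ⟨R₀, hR₀, δ, hδ, hgap⟩ := exists_gap_of_no_antipodal hno
  obtain ⟨B, hB⟩ := AntipodalGap.bddAbove_norm (fun z => (hF z (mem_univ z)).differentiableAt)
    (fun z => (hG z (mem_univ z)).differentiableAt) hfFG hharm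
    (fun z w => hgap (f z) ⟨z, rfl⟩ (f w) ⟨w, rfl⟩) hR₀ hδ
  refine ⟨f 0, fun z => bounded_harmonic_on_complex_plane_is_constant f hharm ?_ z 0⟩
  rw [isBounded_iff_forall_norm_le]
  exact ⟨B, forall_mem_range.2 hB⟩
end

section
/- Let f = u + iv : ℂ → ℂ be a harmonic map such that D(R_f) ⊆ { e^{iθ} : α − π/2 ≤ θ ≤ α + π/2 } for some α ∈ ℝ. Then there exists c ∈ ℝ such that (cos α)·u + (sin α)·v ≡ c on ℂ. In particular R_f is a line or a point. -/
open Complex Metric Filter Set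

open scoped Topology

open InnerProductSpace in
theorem HarmonicFn.harmonicAt {u : ℂ → ℝ} (hu : HarmonicFn u) (z : ℂ) : HarmonicAt u z := by
  refine ⟨hu.1.contDiffAt, Eventually.of_forall fun w => ?_⟩
  simpa [laplacian_eq_iteratedFDeriv_complexPlane] using hu.2 w

/-- A harmonic function is locally constant near a local maximum. -/
theorem InnerProductSpace.HarmonicAt.eventually_eq_of_isLocalMax {φ : ℂ → ℝ} {z : ℂ}
    (hφ : InnerProductSpace.HarmonicAt φ z) (hmax : IsLocalMax φ z) :
    ∀ᶠ w in 𝓝 z, φ w = φ z := by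
  obtain ⟨r, hr, hball⟩ :=
    Metric.isOpen_iff.1 (InnerProductSpace.isOpen_setOfPred_harmonicAt φ) z hφ
  obtain ⟨F, hF, hFφ⟩ :=
    InnerProductSpace.HarmonicOnNhd.exists_analyticOnNhd_ball_re_eq (fun w hw => hball hw)
  have hnear : ∀ᶠ w in 𝓝 z, w ∈ ball z r := ball_mem_nhds z hr
  have hz : (F z).re = φ z := hFφ (mem_ball_self hr)
  have hexp : ∀ᶠ w in 𝓝 z, Complex.exp (F w) = Complex.exp (F z) := by
    refine Complex.eventually_eq_of_isLocalMax_norm (f := fun w => Complex.exp (F w)) ?_ ?_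
    · filter_upwards [hnear] with w hw
      exact (hF w hw).differentiableAt.cexp
    · filter_upwards [hnear, hmax] with w hw hle
      have hw' : (F w).re = φ w := hFφ hw
      simpa [Complex.norm_exp, hw', hz] using hle
  filter_upwards [hnear, hexp] with w hw hwz
  have hw' : (F w).re = φ w := hFφ hw
  have := congrArg norm hwz
  rwa [Complex.norm_exp, Complex.norm_exp, Real.exp_eq_exp, hw', hz] at this

/-- Liouville's theorem for harmonic functions bounded above. -/
theorem harmonic_eq_of_le {u : ℂ → ℝ} (hu : ∀ z, InnerProductSpace.HarmonicAt u z) {K : ℝ}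
    (hK : ∀ z, u z ≤ K) (z w : ℂ) : u z = u w := by
  obtain ⟨F, hF, hFu⟩ :=
    InnerProductSpace.HarmonicOnNhd.exists_analyticOnNhd_univ_re_eq (f := u) (fun w _ => hu w)
  have hre : ∀ w, (F w).re = u w := congrFun hFu
  have hd : Differentiable ℂ (fun w => Complex.exp (F w)) :=
    fun w => (hF w (mem_univ w)).differentiableAt.cexp
  have hb : Bornology.IsBounded (range fun w => Complex.exp (F w)) := by
    refine isBounded_iff_forall_norm_le.2 ⟨Real.exp K, ?_⟩
    rintro _ ⟨w, rfl⟩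
    simpa [Complex.norm_exp, hre] using hK w
  have := congrArg norm (hd.apply_eq_apply_of_bounded hb z w)
  rwa [Complex.norm_exp, Complex.norm_exp, Real.exp_eq_exp, hre, hre] at this

/-- A continuous nonnegative bounded function on the plane that is harmonic wherever it is positive
grows at most like `ε * log ‖z‖` past its maximum over the closed unit disc. -/
theorem le_add_mul_log_of_harmonicAt_of_pos {φ : ℂ → ℝ} (hc : Continuous φ) (h0 : ∀ z, 0 ≤ φ z)
    (hh : ∀ z, 0 < φ z → InnerProductSpace.HarmonicAt φ z) {K : ℝ} (hK : ∀ z, φ z ≤ K)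
    {M : ℝ} (hM : ∀ z, ‖z‖ ≤ 1 → φ z ≤ M) {ε : ℝ} (hε : 0 < ε) {z : ℂ} (hz : 1 ≤ ‖z‖) :
    φ z ≤ M + ε * Real.log ‖z‖ := by
  set ψ : ℂ → ℝ := fun w => φ w - ε * Real.log ‖w‖ with hψ
  set R : ℝ := Real.exp ((K + 1) / ε) + ‖z‖ with hR
  have hlogR : K + 1 ≤ ε * Real.log R := by
    have : (K + 1) / ε ≤ Real.log R := by
      rw [Real.le_log_iff_exp_le (by positivity)]
      linarith
    rwa [div_le_iff₀' hε] at this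
  set A : Set ℂ := {w | 1 ≤ ‖w‖ ∧ ‖w‖ ≤ R} with hA
  have hAcl : IsClosed A :=
    (isClosed_le continuous_const continuous_norm).inter
      (isClosed_le continuous_norm continuous_const)
  have hAc : IsCompact A :=
    (isCompact_closedBall (0 : ℂ) R).of_isClosed_subset hAcl
      (fun w hw => by simpa using hw.2)
  have hψc : ContinuousOn ψ A := by
    refine hc.continuousOn.sub (continuousOn_const.mul
      (continuous_norm.continuousOn.log fun w hw => ?_))
    linarith [hw.1]
  have hzA : z ∈ A := ⟨hz, by linarith [Real.exp_pos ((K + 1) / ε)]⟩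
  have h1A : (1 : ℂ) ∈ A := ⟨by simp, by simpa using hz.trans hzA.2⟩
  obtain ⟨p, hpA, hp⟩ := hAc.exists_isMaxOn ⟨z, hzA⟩ hψc
  have hp' : ∀ w ∈ A, ψ w ≤ ψ p := fun w hw => hp hw
  have hBc : IsCompact (A ∩ ψ ⁻¹' {ψ p}) :=
    hAc.of_isClosed_subset (hψc.preimage_isClosed_of_isClosed hAcl isClosed_singleton)
      inter_subset_left
  obtain ⟨q, ⟨hqA, hqp⟩, hq⟩ := hBc.exists_isMinOn ⟨p, hpA, rfl⟩ continuous_norm.continuousOn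
  have hqp : ψ q = ψ p := hqp
  have hmax : ∀ w ∈ A, ψ w ≤ ψ q := fun w hw => hqp ▸ hp' w hw
  have hψ1 : 0 ≤ ψ q := (by simpa [hψ] using h0 1 : 0 ≤ ψ 1).trans (hmax 1 h1A)
  have hq1 : ‖q‖ = 1 := by
    by_contra hne
    have hlt : 1 < ‖q‖ := lt_of_le_of_ne hqA.1 (Ne.symm hne)
    have hltR : ‖q‖ < R := by
      refine lt_of_le_of_ne hqA.2 fun h => ?_
      simp only [hψ, h] at hψ1
      linarith [hK q]
    have hpos : 0 < φ q := by
      have := mul_pos hε (Real.log_pos hlt)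
      simp only [hψ] at hψ1
      linarith
    have hharm : InnerProductSpace.HarmonicAt ψ q := by
      have hlog : InnerProductSpace.HarmonicAt (fun w : ℂ => Real.log ‖w‖) q :=
        AnalyticAt.harmonicAt_log_norm (f := fun w => w) analyticAt_id
          (norm_pos_iff.1 (by linarith))
      exact (hh q hpos).sub (hlog.const_smul (c := ε))
    have hnear : ∀ᶠ w in 𝓝 q, w ∈ A := by
      filter_upwards [continuous_norm.continuousAt.eventually (lt_mem_nhds hlt),
        continuous_norm.continuousAt.eventually (gt_mem_nhds hltR)] with w h1 h2
      exact ⟨h1.le, h2.le⟩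
    have hloc := hharm.eventually_eq_of_isLocalMax (hnear.mono hmax)
    have hlim : Tendsto (fun t : ℝ => (t : ℂ) * q) (𝓝[<] 1) (𝓝 q) := by
      have : Continuous fun t : ℝ => (t : ℂ) * q := by fun_prop
      exact (by simpa using this.tendsto 1 :
        Tendsto (fun t : ℝ => (t : ℂ) * q) (𝓝 1) (𝓝 q)).mono_left nhdsWithin_le_nhds
    obtain ⟨t, ⟨htA, hteq⟩, ht0, ht1⟩ := ((hlim.eventually (hnear.and hloc)).and
      (Ioo_mem_nhdsLT (zero_lt_one (α := ℝ)))).exists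
    have hle : ‖q‖ ≤ ‖(t : ℂ) * q‖ := hq ⟨htA, hteq.trans hqp⟩
    rw [norm_mul, Complex.norm_real, Real.norm_of_nonneg ht0.le] at hle
    nlinarith
  have hzq := hmax z hzA
  have hqM := hM q hq1.le
  simp only [hψ, hq1, Real.log_one] at hzq
  linarith

/-- Liouville's theorem for the bounded subharmonic functions that are nonnegative, continuous and
harmonic wherever they are positive. -/
theorem eq_of_harmonicAt_of_pos {φ : ℂ → ℝ} (hc : Continuous φ) (h0 : ∀ z, 0 ≤ φ z)
    (hh : ∀ z, 0 < φ z → InnerProductSpace.HarmonicAt φ z) {K : ℝ} (hK : ∀ z, φ z ≤ K)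
    (z w : ℂ) : φ z = φ w := by
  obtain ⟨p, -, hp⟩ := (isCompact_closedBall (0 : ℂ) 1).exists_isMaxOn ⟨0, by simp⟩ hc.continuousOn
  have hdisc : ∀ z, ‖z‖ ≤ 1 → φ z ≤ φ p := fun z hz => hp (by simpa using hz)
  have hmax : ∀ z, φ z ≤ φ p := by
    intro z
    rcases le_total ‖z‖ 1 with hz | hz
    · exact hdisc z hz
    have hlim : Tendsto (fun ε : ℝ => φ p + ε * Real.log ‖z‖) (𝓝[>] 0) (𝓝 (φ p)) := by
      have : Continuous fun ε : ℝ => φ p + ε * Real.log ‖z‖ := by fun_prop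
      exact (by simpa using this.tendsto 0 : Tendsto _ (𝓝 (0 : ℝ)) (𝓝 (φ p))).mono_left
        nhdsWithin_le_nhds
    refine ge_of_tendsto hlim ?_
    filter_upwards [self_mem_nhdsWithin] with ε hε
    exact le_add_mul_log_of_harmonicAt_of_pos hc h0 hh hK hdisc hε hz
  suffices ∀ z, φ z = φ p by rw [this z, this w]
  rcases (h0 p).eq_or_lt with hp0 | hp0
  · exact fun z => le_antisymm (hmax z) (hp0 ▸ h0 z)
  have hclopen : IsClopen (φ ⁻¹' {φ p}) := by
    refine ⟨isClosed_singleton.preimage hc, isOpen_iff_mem_nhds.2 fun q hq => ?_⟩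
    have hq : φ q = φ p := hq
    have := (hh q (hq ▸ hp0)).eventually_eq_of_isLocalMax
      (Eventually.of_forall fun w => hq ▸ hmax w)
    filter_upwards [this] with w hw
    exact hw.trans hq
  intro z
  have : z ∈ φ ⁻¹' {φ p} := hclopen.eq_univ ⟨p, rfl⟩ ▸ mem_univ z
  exact this

/-- If the negative part of a harmonic function is `o(|V|) + O(1)` for a harmonic `V`, then the
function is constant. -/
theorem harmonic_eq_of_neg_le {U V : ℂ → ℝ} (hU : ∀ z, InnerProductSpace.HarmonicAt U z)
    (hV : ∀ z, InnerProductSpace.HarmonicAt V z)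
    (h : ∀ δ : ℝ, 0 < δ → ∃ C : ℝ, ∀ z, -U z ≤ δ * |V z| + C) (z₁ z₂ : ℂ) :
    U z₁ = U z₂ := by
  by_contra hne
  have hUc : Continuous U := continuous_iff_continuousAt.2 fun z => (hU z).1.continuousAt
  have hVc : Continuous V := continuous_iff_continuousAt.2 fun z => (hV z).1.continuousAt
  obtain ⟨C₁, hC₁⟩ := h 1 one_pos
  obtain ⟨a, ha⟩ : ∃ a, C₁ < -U a := by
    by_contra! hle
    exact hne (neg_injective
      (harmonic_eq_of_le (u := fun z => -U z) (fun z => (hU z).neg) hle z₁ z₂))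
  have hmain : ∀ δ : ℝ, 0 < δ → -U a - C₁ ≤ δ * |V a| := by
    intro δ hδ
    obtain ⟨C, hC⟩ := h δ hδ
    by_contra! hlt
    set φ : ℂ → ℝ := fun z => max (-U z - C₁ - δ * |V z|) 0 with hφ
    have hφc : Continuous φ := by fun_prop
    have hharm : ∀ z, 0 < φ z → InnerProductSpace.HarmonicAt φ z := by
      intro z hz
      have hev : ∀ᶠ y in 𝓝 z, φ y = -U y - C₁ - δ * |V y| := by
        filter_upwards [hφc.continuousAt.eventually (lt_mem_nhds hz)] with y hy
        rcases lt_max_iff.1 hy with hy | hy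
        · exact max_eq_left hy.le
        · exact absurd hy (lt_irrefl 0)
      have hVz : V z ≠ 0 := by
        intro h0
        have h1 := hC₁ z
        have h2 := hev.self_of_nhds
        simp only [h0, abs_zero] at h1 h2
        linarith
      have hlin : ∀ s : ℝ, InnerProductSpace.HarmonicAt (fun y => -U y - C₁ - (δ * s) * V y) z :=
        fun s => (((hU z).neg).sub (InnerProductSpace.harmonicAt_const C₁)).sub
          ((hV z).const_smul (c := δ * s))
      rcases lt_or_gt_of_ne hVz with hneg | hpos
      · refine (InnerProductSpace.harmonicAt_congr_nhds ?_).2 (hlin (-1))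
        filter_upwards [hev, hVc.continuousAt.eventually (gt_mem_nhds hneg)] with y hy hVy
        rw [hy, abs_of_neg hVy]
        ring
      · refine (InnerProductSpace.harmonicAt_congr_nhds ?_).2 (hlin 1)
        filter_upwards [hev, hVc.continuousAt.eventually (lt_mem_nhds hpos)] with y hy hVy
        rw [hy, abs_of_pos hVy]
        ring
    have hbdd : ∀ z, φ z ≤ max (C - C₁) 0 := fun z =>
      max_le_max (by linarith [hC z]) le_rfl
    have hconst := eq_of_harmonicAt_of_pos hφc (fun z => le_max_right _ _) hharm hbdd
    have hφa : 0 < φ a := lt_max_of_lt_left (by linarith)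
    have hall : ∀ z, U z ≤ -C₁ := by
      intro z
      have hz : 0 < φ z := hconst a z ▸ hφa
      rcases lt_max_iff.1 hz with hz | hz
      · nlinarith [mul_nonneg hδ.le (abs_nonneg (V z))]
      · exact absurd hz (lt_irrefl 0)
    exact hne (harmonic_eq_of_le hU hall z₁ z₂)
  have hlim : Tendsto (fun δ : ℝ => δ * |V a|) (𝓝[>] 0) (𝓝 0) := by
    have : Continuous fun δ : ℝ => δ * |V a| := by fun_prop
    exact (by simpa using this.tendsto 0 : Tendsto _ (𝓝 (0 : ℝ)) (𝓝 (0 : ℝ))).mono_left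
      nhdsWithin_le_nhds
  have := ge_of_tendsto hlim (eventually_mem_nhdsWithin.mono fun δ hδ => hmain δ hδ)
  linarith

/-- A sequence in `R` tending to infinity has a subsequence whose normalizations converge to an
asymptotic direction of `R`. -/
theorem exists_asympDir_of_tendsto_norm {R : Set ℂ} {w : ℕ → ℂ} (hw : ∀ n, w n ∈ R)
    (hlim : Tendsto (fun n => ‖w n‖) atTop atTop) :
    ∃ ζ ∈ asympDirs R, ∃ k : ℕ → ℕ, StrictMono k ∧
      Tendsto (fun n => ((‖w (k n)‖⁻¹ : ℝ) : ℂ) * w (k n)) atTop (𝓝 ζ) := by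
  obtain ⟨N, hN⟩ := eventually_atTop.1 (hlim.eventually_gt_atTop 0)
  have hN : ∀ n, 0 < ‖w (n + N)‖ := fun n => hN _ (Nat.le_add_left N n)
  obtain ⟨ζ, hζ, k, hk, hkζ⟩ := (isCompact_sphere (0 : ℂ) 1).tendsto_subseq
    (x := fun n => ((‖w (n + N)‖⁻¹ : ℝ) : ℂ) * w (n + N)) (fun n => by
      have := (hN n).ne'
      simp [this])
  have hmono : StrictMono fun n => k n + N := fun m n hmn => Nat.add_lt_add_right (hk hmn) N
  have hε : Tendsto (fun n => ‖w (k n + N)‖⁻¹) atTop (𝓝 0) :=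
    (hlim.comp hmono.tendsto_atTop).inv_tendsto_atTop
  have hζ1 : ‖ζ‖ = 1 := mem_sphere_zero_iff_norm.1 hζ
  exact ⟨ζ, ⟨hζ1, fun n => w (k n + N), fun n => hw _,
    fun n => ‖w (k n + N)‖⁻¹, fun n => inv_pos.2 (hN _), hε, hkζ⟩, _, hmono, hkζ⟩

/-- If every asymptotic direction of `R` lies in the closed half-plane `Re (a z) ≥ 0`, then on `R`
the negative part of `Re (a z)` is `o(|Im (a z)|) + O(1)`. -/
theorem neg_re_le_of_asympDirs {R : Set ℂ} {a : ℂ} (ha : a ≠ 0)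
    (hR : ∀ ζ ∈ asympDirs R, 0 ≤ (a * ζ).re) {δ : ℝ} (hδ : 0 < δ) :
    ∃ C : ℝ, ∀ w ∈ R, -(a * w).re ≤ δ * |(a * w).im| + C := by
  by_contra! h
  choose w hwR hw using fun n : ℕ => h n
  have hna : 0 < ‖a‖ := norm_pos_iff.2 ha
  have hnorm : ∀ n : ℕ, (n : ℝ) ≤ ‖a‖ * ‖w n‖ := by
    intro n
    rw [← norm_mul]
    have h1 := (neg_le_abs _).trans (Complex.abs_re_le_norm (a * w n))
    have h2 := mul_nonneg hδ.le (abs_nonneg (a * w n).im)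
    linarith [hw n]
  have hlim : Tendsto (fun n => ‖w n‖) atTop atTop :=
    (tendsto_const_mul_atTop_of_pos hna).1
      (tendsto_atTop_mono hnorm tendsto_natCast_atTop_atTop)
  obtain ⟨ζ, hζ, k, -, hkζ⟩ := exists_asympDir_of_tendsto_norm hwR hlim
  have hle : (a * ζ).re + δ * |(a * ζ).im| ≤ 0 := by
    have hcont : Continuous fun x : ℂ => (a * x).re + δ * |(a * x).im| := by fun_prop
    refine le_of_tendsto ((hcont.tendsto ζ).comp hkζ) (Eventually.of_forall fun n => ?_)
    have hinv : 0 ≤ ‖w (k n)‖⁻¹ := by positivity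
    have hlt : (a * w (k n)).re + δ * |(a * w (k n)).im| ≤ 0 := by
      have := hw (k n)
      have h2 : (0 : ℝ) ≤ k n := Nat.cast_nonneg _
      linarith
    simp only [Function.comp_apply, mul_left_comm a, Complex.re_ofReal_mul, Complex.im_ofReal_mul,
      abs_mul, abs_of_nonneg hinv]
    nlinarith
  have hre := hR ζ hζ
  have hmul := mul_nonneg hδ.le (abs_nonneg (a * ζ).im)
  have him : (a * ζ).im = 0 :=
    abs_eq_zero.1 ((mul_eq_zero.1 (by linarith : δ * |(a * ζ).im| = 0)).resolve_left hδ.ne')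
  have hzero : a * ζ = 0 := Complex.ext (by simp only [zero_re]; linarith) him
  have hζ1 : ‖ζ‖ = 1 := hζ.1
  rcases mul_eq_zero.1 hzero with h0 | h0
  · exact ha h0
  · simp [h0] at hζ1

/-- A harmonic function on the plane is constant or surjective. -/
theorem harmonic_const_or_surjective {u : ℂ → ℝ}
    (hu : ∀ z, InnerProductSpace.HarmonicAt u z) :
    (∀ z w, u z = u w) ∨ Function.Surjective u := by
  by_cases hconst : ∀ z w, u z = u w
  · exact Or.inl hconst
  right
  have hc : Continuous u := continuous_iff_continuousAt.2 fun z => (hu z).1.continuousAt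
  intro t
  obtain ⟨b, hb⟩ : ∃ b, t < u b := by
    by_contra! h
    exact hconst (harmonic_eq_of_le hu h)
  obtain ⟨a, ha⟩ : ∃ a, u a < t := by
    by_contra! h
    exact hconst fun z w => neg_injective (harmonic_eq_of_le (u := fun z => -u z)
      (fun z => (hu z).neg) (fun z => neg_le_neg (h z)) z w)
  exact mem_range_of_exists_le_of_exists_ge hc ⟨a, ha.le⟩ ⟨b, hb.le⟩

/-- **Theorem 2.** If `f = u + iv` is a harmonic map whose asymptotic directions all lie in the
closed half-circle `{e^{iθ} : α - π/2 ≤ θ ≤ α + π/2}`, then `(cos α)·u + (sin α)·v` is constant;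
in particular the range of `f` is a line or a point. -/
theorem asympDirs_in_halfcircle_implies_linear_relation
    (u v : ℂ → ℝ) (hu : HarmonicFn u) (hv : HarmonicFn v)
    (f : ℂ → ℂ) (hf : ∀ z, f z = (u z : ℂ) + (v z : ℂ) * Complex.I)
    (α : ℝ)
    (hD : asympDirs (Set.range f) ⊆
      {ζ : ℂ | ∃ θ : ℝ, α - Real.pi / 2 ≤ θ ∧ θ ≤ α + Real.pi / 2 ∧
        ζ = Complex.exp (θ * Complex.I)}) :
    (∃ c : ℝ, ∀ z, Real.cos α * u z + Real.sin α * v z = c) ∧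
    ((∃ p : ℂ, Set.range f = {p}) ∨
      ∃ p d : ℂ, d ≠ 0 ∧ Set.range f = {w : ℂ | ∃ t : ℝ, w = p + (t : ℂ) * d}) := by
  set a : ℂ := Complex.exp (-α * Complex.I) with ha
  set U : ℂ → ℝ := fun z => Real.cos α * u z + Real.sin α * v z with hUdef
  set V : ℂ → ℝ := fun z => Real.cos α * v z - Real.sin α * u z with hVdef
  have hU : ∀ z, InnerProductSpace.HarmonicAt U z := fun z =>
    ((hu.harmonicAt z).const_smul (c := Real.cos α)).add
      ((hv.harmonicAt z).const_smul (c := Real.sin α))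
  have hV : ∀ z, InnerProductSpace.HarmonicAt V z := fun z =>
    ((hv.harmonicAt z).const_smul (c := Real.cos α)).sub
      ((hu.harmonicAt z).const_smul (c := Real.sin α))
  have ha_re : a.re = Real.cos α := by simp [ha, Complex.exp_re]
  have ha_im : a.im = -Real.sin α := by simp [ha, Complex.exp_im]
  have hre : ∀ z, (a * f z).re = U z := fun z => by
    simp [hf, ha_re, ha_im, hUdef]
  have him : ∀ z, (a * f z).im = V z := fun z => by
    simp [hf, ha_re, ha_im, hVdef]
    ring
  have hdir : ∀ ζ ∈ asympDirs (range f), 0 ≤ (a * ζ).re := by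
    intro ζ hζ
    obtain ⟨θ, h1, h2, rfl⟩ := hD hζ
    have : a * Complex.exp (θ * Complex.I) = Complex.exp ((θ - α : ℝ) * Complex.I) := by
      rw [ha, ← Complex.exp_add]
      push_cast
      ring_nf
    rw [this, Complex.exp_ofReal_mul_I_re]
    exact Real.cos_nonneg_of_mem_Icc ⟨by linarith, by linarith⟩
  have hconst : ∀ z, U z = U 0 := fun z => harmonic_eq_of_neg_le hU hV (fun δ hδ => by
    obtain ⟨C, hC⟩ := neg_re_le_of_asympDirs (Complex.exp_ne_zero _) hdir hδ
    exact ⟨C, fun z => by simpa only [← hre, ← him] using hC (f z) (mem_range_self z)⟩) z 0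
  refine ⟨⟨U 0, hconst⟩, ?_⟩
  have hf' : ∀ z, f z = a⁻¹ * U 0 + V z * (a⁻¹ * Complex.I) := by
    intro z
    have : a * f z = U 0 + V z * Complex.I := by
      rw [← hconst z, ← hre, ← him, Complex.re_add_im]
    rw [← inv_mul_cancel_left₀ (Complex.exp_ne_zero _ : a ≠ 0) (f z), this]
    ring
  rcases harmonic_const_or_surjective hV with hVc | hVs
  · left
    refine ⟨f 0, eq_singleton_iff_unique_mem.2 ⟨mem_range_self 0, ?_⟩⟩
    rintro _ ⟨z, rfl⟩
    rw [hf', hf' 0, hVc z 0]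
  · right
    refine ⟨a⁻¹ * U 0, a⁻¹ * Complex.I,
      mul_ne_zero (inv_ne_zero (Complex.exp_ne_zero _)) Complex.I_ne_zero, ?_⟩
    ext w
    constructor
    · rintro ⟨z, rfl⟩
      exact ⟨V z, hf' z⟩
    · rintro ⟨t, rfl⟩
      obtain ⟨z, rfl⟩ := hVs t
      exact ⟨z, hf' z⟩
end

section
/- Let f = u + iv : ℂ → ℂ be a harmonic map. Suppose there exist 0 ≤ α < 1, a ≥ 0 and b ∈ ℝ such that v(z) ≤ a·|u(z)|^α + b for every z ∈ ℂ. Then v is constant. In particular R_f is a (horizontal) line or a point. -/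
open Complex Metric Filter Set

theorem HarmonicFn.exists_differentiable_re_eq {u : ℂ → ℝ} (hu : HarmonicFn u) :
    ∃ F : ℂ → ℂ, Differentiable ℂ F ∧ ∀ z, (F z).re = u z := by
  have h : InnerProductSpace.HarmonicOnNhd u univ := by
    refine fun z _ => ⟨hu.1.contDiffAt, Filter.Eventually.of_forall fun w => ?_⟩
    rw [InnerProductSpace.laplacian_eq_iteratedFDeriv_complexPlane]
    exact hu.2 w
  obtain ⟨F, hF, hFu⟩ := h.exists_analyticOnNhd_univ_re_eq
  exact ⟨F, fun z => (hF z (mem_univ z)).differentiableAt, congrFun hFu⟩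

/-- Liouville's theorem for an entire function whose real part is bounded above. -/
theorem Differentiable.re_eq_of_re_le {F : ℂ → ℂ} (hF : Differentiable ℂ F) {C : ℝ}
    (hC : ∀ z, (F z).re ≤ C) (z w : ℂ) : (F z).re = (F w).re := by
  have h : Complex.exp (F z) = Complex.exp (F w) := by
    refine (Complex.differentiable_exp.comp hF).apply_eq_apply_of_bounded ?_ z w
    rw [isBounded_iff_forall_norm_le]
    refine ⟨Real.exp C, ?_⟩
    rintro _ ⟨y, rfl⟩
    simpa [Complex.norm_exp] using hC y
  simpa [Complex.norm_exp] using congrArg (‖·‖) h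

/-- A Phragmén–Lindelöf principle: if `re H` is bounded above on a set `W` that stays away
from some point, and `re H ≤ 0` on the boundary of `W`, then `re H ≤ 0` on `W`. -/
theorem Differentiable.re_nonpos_of_frontier {H : ℂ → ℂ} (hH : Differentiable ℂ H) {W : Set ℂ}
    {z₀ : ℂ} {r C : ℝ} (hr : 0 < r) (hWr : ∀ z ∈ W, r ≤ ‖z - z₀‖)
    (hC : ∀ z ∈ W, (H z).re ≤ C) (hfr : ∀ z ∈ frontier W, (H z).re ≤ 0) {z : ℂ} (hz : z ∈ W) :
    (H z).re ≤ 0 := by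
  have hcl : ∀ y ∈ closure W, r ≤ ‖y - z₀‖ := fun y hy =>
    closure_minimal (t := {y | r ≤ ‖y - z₀‖}) hWr
      (isClosed_le continuous_const (by fun_prop)) hy
  have hclC : ∀ y ∈ closure W, (H y).re ≤ C := fun y hy =>
    closure_minimal (t := {y | (H y).re ≤ C}) hC
      (isClosed_le (Complex.continuous_re.comp hH.continuous) continuous_const) hy
  have key : ∀ n : ℕ, Real.exp (n * (H z).re) ≤ ‖z - z₀‖ / r := by
    intro n
    set R : ℝ := ‖z - z₀‖ + 1 + r * Real.exp (n * C) with hR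
    have hE : 0 < r * Real.exp (n * C) := by positivity
    have hRpos : 0 < R := by positivity
    set φ : ℂ → ℂ := fun y => Complex.exp (n * H y) * (r / (y - z₀)) with hφ
    have hnorm : ∀ y, ‖φ y‖ = Real.exp (n * (H y).re) * (r / ‖y - z₀‖) := by
      intro y
      simp [hφ, Complex.norm_exp, abs_of_pos hr]
    have hzU : z ∈ W ∩ ball z₀ R := ⟨hz, by rw [mem_ball, dist_eq_norm]; linarith⟩
    have hd : DiffContOnCl ℂ φ (W ∩ ball z₀ R) := by
      refine DifferentiableOn.diffContOnCl fun y hy => ?_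
      have hy0 : y - z₀ ≠ 0 :=
        norm_pos_iff.1 (hr.trans_le (hcl y (closure_mono inter_subset_left hy)))
      have hHy := hH y
      refine DifferentiableAt.differentiableWithinAt ?_
      simp only [hφ]
      fun_prop (disch := assumption)
    have hbd : ∀ y ∈ frontier (W ∩ ball z₀ R), ‖φ y‖ ≤ 1 := by
      intro y hy
      rw [hnorm]
      have hyc : y ∈ closure W := closure_mono inter_subset_left (frontier_subset_closure hy)
      have hyr := hcl y hyc
      have hy0 : 0 < ‖y - z₀‖ := hr.trans_le hyr
      rcases frontier_inter_subset _ _ hy with h | h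
      · have h1 : Real.exp (n * (H y).re) ≤ 1 :=
          Real.exp_le_one_iff.2 (mul_nonpos_of_nonneg_of_nonpos n.cast_nonneg (hfr y h.1))
        exact mul_le_one₀ h1 (by positivity) ((div_le_one hy0).2 hyr)
      · have h2 : ‖y - z₀‖ = R := by
          have := frontier_ball_subset_sphere h.2
          rwa [mem_sphere, dist_eq_norm] at this
        have h1 : Real.exp (n * (H y).re) ≤ Real.exp (n * C) :=
          Real.exp_le_exp.2 (mul_le_mul_of_nonneg_left (hclC y hyc) n.cast_nonneg)
        rw [h2, ← mul_div_assoc, div_le_one hRpos]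
        nlinarith [norm_nonneg (z - z₀)]
    have := Complex.norm_le_of_forall_mem_frontier_norm_le
      (isBounded_ball.subset inter_subset_right) hd hbd (subset_closure hzU)
    rw [hnorm, ← mul_div_assoc, div_le_one (hr.trans_le (hWr z hz))] at this
    rwa [le_div_iff₀ hr]
  by_contra! hpos
  obtain ⟨n, hn⟩ := exists_nat_gt (‖z - z₀‖ / r / (H z).re)
  rw [div_lt_iff₀ hpos] at hn
  linarith [key n, Real.add_one_le_exp (n * (H z).re)]

/-- If `re G ≤ ε |re F| + C_ε` for every `ε > 0`, and `re G ≤ c` on the zeros of `re F`,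
then `re G ≤ c` wherever `re F` is positive. -/
theorem re_le_of_sublinear_of_re_pos {F G : ℂ → ℂ} (hF : Differentiable ℂ F)
    (hG : Differentiable ℂ G) {c : ℝ} {z₀ : ℂ} (hz₀ : (G z₀).re < c)
    (hsub : ∀ ε > 0, ∃ C, ∀ z, (G z).re ≤ ε * |(F z).re| + C)
    (hzero : ∀ z, (F z).re = 0 → (G z).re ≤ c) {z : ℂ} (hz : 0 < (F z).re) :
    (G z).re ≤ c := by
  have hFc : Continuous fun y => (F y).re := Complex.continuous_re.comp hF.continuous
  have hGc : Continuous fun y => (G y).re := Complex.continuous_re.comp hG.continuous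
  by_contra! hzG
  set W : Set ℂ := {y | 0 < (F y).re} ∩ {y | c < (G y).re}
  obtain ⟨r, hr, hball⟩ := Metric.isOpen_iff.1 (isOpen_lt hGc continuous_const) z₀ hz₀
  have hWr : ∀ y ∈ W, r ≤ ‖y - z₀‖ := by
    intro y hy
    by_contra! h
    have hyc : (G y).re < c := hball (by rwa [mem_ball, dist_eq_norm])
    exact lt_asymm hy.2 hyc
  have key : ∀ ε > 0, (G z).re - c - ε * (F z).re ≤ 0 := by
    intro ε hε
    obtain ⟨C, hC⟩ := hsub ε hε
    have := Differentiable.re_nonpos_of_frontier (H := fun y => G y - c - ε * F y)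
      (by fun_prop) hr hWr (C := C - c) ?_ ?_ (show z ∈ W from ⟨hz, hzG⟩)
    · simpa using this
    · intro y hy
      have h1 := hC y
      rw [abs_of_pos hy.1] at h1
      simp
      linarith
    · intro y hy
      have hyF : 0 ≤ (F y).re := closure_lt_subset_le continuous_const hFc
        (closure_mono inter_subset_left (frontier_subset_closure hy))
      have hyG : (G y).re ≤ c := by
        rcases frontier_inter_subset _ _ hy with h | h
        · exact hzero y (frontier_lt_subset_eq continuous_const hFc h.1).symm
        · exact (frontier_lt_subset_eq continuous_const hGc h.2).symm.le
      simp
      nlinarith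
  have := key (((G z).re - c) / (2 * (F z).re)) (div_pos (by linarith) (by linarith))
  have h2 : ((G z).re - c) / (2 * (F z).re) * (F z).re = ((G z).re - c) / 2 := by
    field_simp
  linarith

theorem Real.exists_mul_rpow_le_mul_add {α a ε : ℝ} (hα0 : 0 ≤ α) (hα1 : α < 1) (ha : 0 ≤ a)
    (hε : 0 < ε) : ∃ C, ∀ t, 0 ≤ t → a * t ^ α ≤ ε * t + C := by
  obtain ⟨T, hT1, hT⟩ := ((Filter.eventually_ge_atTop 1).and
    ((tendsto_rpow_atTop (sub_pos.2 hα1)).eventually_ge_atTop (a / ε))).exists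
  refine ⟨a * T ^ α, fun t ht => ?_⟩
  have hT0 : 0 ≤ T := by linarith
  rcases le_total t T with h | h
  · have : a * t ^ α ≤ a * T ^ α :=
      mul_le_mul_of_nonneg_left (Real.rpow_le_rpow ht h hα0) ha
    nlinarith [mul_nonneg hε.le ht]
  · have htpos : 0 < t := by linarith
    have h1 : a ≤ ε * t ^ (1 - α) := by
      have := hT.trans (Real.rpow_le_rpow hT0 h (sub_pos.2 hα1).le)
      rwa [div_le_iff₀ hε, mul_comm] at this
    have h2 : t ^ (1 - α) * t ^ α = t := by
      rw [← Real.rpow_add htpos]; simp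
    have h3 : a * t ^ α ≤ ε * t ^ (1 - α) * t ^ α :=
      mul_le_mul_of_nonneg_right h1 (Real.rpow_nonneg ht α)
    rw [mul_assoc, h2] at h3
    have : 0 ≤ a * T ^ α := mul_nonneg ha (Real.rpow_nonneg hT0 α)
    linarith

/-- The real part of an entire function is constant or surjective. -/
theorem Differentiable.re_const_or_surjective {F : ℂ → ℂ} (hF : Differentiable ℂ F) :
    (∀ z w, (F z).re = (F w).re) ∨ Function.Surjective fun z => (F z).re := by
  by_contra! h
  obtain ⟨⟨z, w, hzw⟩, hs⟩ := h
  refine hs fun t => ?_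
  have h1 : ∃ x, t ≤ (F x).re := by
    by_contra! hx
    exact hzw (hF.re_eq_of_re_le (fun y => (hx y).le) z w)
  have h2 : ∃ x, (F x).re ≤ t := by
    by_contra! hx
    refine hzw (neg_injective ?_)
    simpa using hF.neg.re_eq_of_re_le (C := -t) (fun y => by simpa using (hx y).le) z w
  obtain ⟨x, hx⟩ := h1
  obtain ⟨y, hy⟩ := h2
  exact mem_range_of_exists_le_of_exists_ge (Complex.continuous_re.comp hF.continuous)
    ⟨y, hy⟩ ⟨x, hx⟩

/-- **Corollary.** If `f = u + iv` is a harmonic map with `v ≤ a·|u|^α + b` for some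
`0 ≤ α < 1`, `a ≥ 0`, `b ∈ ℝ`, then `v` is constant; in particular the range of `f` is a
(horizontal) line or a point. -/
theorem sublinear_bound_implies_v_constant
    (u v : ℂ → ℝ) (hu : HarmonicFn u) (hv : HarmonicFn v)
    (f : ℂ → ℂ) (hf : ∀ z, f z = (u z : ℂ) + (v z : ℂ) * Complex.I)
    (α a b : ℝ) (hα0 : 0 ≤ α) (hα1 : α < 1) (ha : 0 ≤ a)
    (hbound : ∀ z, v z ≤ a * |u z| ^ α + b) :
    (∃ c : ℝ, ∀ z, v z = c) ∧
    ((∃ p : ℂ, Set.range f = {p}) ∨ ∃ c : ℝ, Set.range f = {w : ℂ | w.im = c}) := by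
  obtain ⟨F, hF, hFu⟩ := hu.exists_differentiable_re_eq
  obtain ⟨G, hG, hGv⟩ := hv.exists_differentiable_re_eq
  have hsub : ∀ ε > 0, ∃ C, ∀ z, (G z).re ≤ ε * |(F z).re| + C := by
    intro ε hε
    obtain ⟨C, hC⟩ := Real.exists_mul_rpow_le_mul_add hα0 hα1 ha hε
    refine ⟨C + b, fun z => ?_⟩
    rw [hGv, hFu]
    linarith [hbound z, hC _ (abs_nonneg (u z))]
  set c : ℝ := a + |b| + |v 0| + 1 with hc
  have hz₀ : (G 0).re < c := by
    rw [hGv]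
    linarith [le_abs_self (v 0), abs_nonneg b]
  have hzero : ∀ z, (F z).re = 0 → (G z).re ≤ c := by
    intro z hz
    rw [hFu] at hz
    have h := hbound z
    rw [hz, abs_zero] at h
    have h1 : a * (0 : ℝ) ^ α ≤ a :=
      mul_le_of_le_one_right ha (Real.rpow_le_one le_rfl zero_le_one hα0)
    rw [hGv]
    linarith [le_abs_self b, abs_nonneg (v 0)]
  have hle : ∀ z, (G z).re ≤ c := by
    intro z
    rcases lt_trichotomy (F z).re 0 with h | h | h
    · exact re_le_of_sublinear_of_re_pos hF.neg hG hz₀ (by simpa using hsub) (by simpa using hzero)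
        (by simpa using h)
    · exact hzero z h
    · exact re_le_of_sublinear_of_re_pos hF hG hz₀ hsub hzero h
  have hvc : ∀ z, v z = v 0 := fun z => by
    rw [← hGv, ← hGv]
    exact hG.re_eq_of_re_le hle z 0
  refine ⟨⟨v 0, hvc⟩, ?_⟩
  rcases hF.re_const_or_surjective with h | h
  · left
    refine ⟨f 0, ?_⟩
    have : f = fun _ => f 0 := by
      funext z
      rw [hf, hf, hvc z, ← hFu, ← hFu, h z 0]
    rw [this, range_const]
  · right
    refine ⟨v 0, Set.ext fun w => ⟨?_, fun hw => ?_⟩⟩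
    · rintro ⟨z, rfl⟩
      simp [hf, hvc z]
    · obtain ⟨z, hz⟩ := h w.re
      refine ⟨z, Complex.ext ?_ ?_⟩
      · simpa [hf, ← hFu] using hz
      · have : w.im = v 0 := hw
        simp [hf, hvc z, this]
end

section
/- If f = u + iv : ℂ → ℂ is a nonconstant harmonic map, then D(R_f), the set of asymptotic directions of its range R_f = f(ℂ), is a nonempty closed subset of the unit circle ∂𝔻. -/
open Complex Metric Filter Set

theorem HarmonicFn.harmonicOnNhd_univ {u : ℂ → ℝ} (hu : HarmonicFn u) :
    InnerProductSpace.HarmonicOnNhd u univ := fun _ _ =>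
  ⟨hu.1.contDiffAt, Eventually.of_forall fun z => by
    simpa [InnerProductSpace.laplacian_eq_iteratedFDeriv_complexPlane] using hu.2 z⟩

theorem mem_asympDirs_iff {R : Set ℂ} {ζ : ℂ} :
    ζ ∈ asympDirs R ↔
      ‖ζ‖ = 1 ∧ ∀ δ > 0, ∃ w ∈ R, ∃ ε : ℝ, 0 < ε ∧ ε < δ ∧ dist ((ε : ℂ) * w) ζ < δ := by
  refine and_congr_right fun _ => ⟨?_, fun h => ?_⟩
  · rintro ⟨w, hw, ε, hε, hε0, hlim⟩ δ hδ
    obtain ⟨n, hn, hn'⟩ :=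
      ((hε0.eventually_lt_const hδ).and (Metric.tendsto_nhds.1 hlim δ hδ)).exists
    exact ⟨w n, hw n, ε n, hε n, hn, hn'⟩
  · choose w hw ε hε hεlt hdist using fun n : ℕ => h (1 / ((n : ℝ) + 1)) Nat.one_div_pos_of_nat
    refine ⟨w, hw, ε, hε, ?_, tendsto_iff_dist_tendsto_zero.2 ?_⟩
    · exact squeeze_zero (fun n => (hε n).le) (fun n => (hεlt n).le)
        tendsto_one_div_add_atTop_nhds_zero_nat
    · exact squeeze_zero (fun n => dist_nonneg) (fun n => (hdist n).le)
        tendsto_one_div_add_atTop_nhds_zero_nat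

theorem asympDirs_subset_sphere (R : Set ℂ) : asympDirs R ⊆ sphere (0 : ℂ) 1 :=
  fun _ hζ => mem_sphere_zero_iff_norm.2 hζ.1

theorem isClosed_asympDirs (R : Set ℂ) : IsClosed (asympDirs R) := by
  refine isClosed_of_closure_subset fun ζ hζ => mem_asympDirs_iff.2 ⟨?_, fun δ hδ => ?_⟩
  · exact mem_sphere_zero_iff_norm.1
      (closure_minimal (asympDirs_subset_sphere R) isClosed_sphere hζ)
  · obtain ⟨ξ, hξ, hdist⟩ := Metric.mem_closure_iff.1 hζ (δ / 2) (half_pos hδ)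
    obtain ⟨w, hw, ε, hε, hεlt, hw'⟩ := (mem_asympDirs_iff.1 hξ).2 (δ / 2) (half_pos hδ)
    refine ⟨w, hw, ε, hε, by linarith, ?_⟩
    have := dist_triangle_right ((ε : ℂ) * w) ζ ξ
    linarith

theorem asympDirs_nonempty_of_not_isBounded {R : Set ℂ} (hR : ¬ Bornology.IsBounded R) :
    (asympDirs R).Nonempty := by
  have hlarge (n : ℕ) : ∃ w ∈ R, (n : ℝ) + 1 < ‖w‖ := by
    by_contra! h
    exact hR (isBounded_iff_forall_norm_le.2 ⟨_, h⟩)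
  choose w hw hnorm using hlarge
  have hpos (n : ℕ) : 0 < ‖w n‖ := (by positivity : (0 : ℝ) < n + 1).trans (hnorm n)
  have hmem (n : ℕ) : ((‖w n‖⁻¹ : ℝ) : ℂ) * w n ∈ sphere (0 : ℂ) 1 := by
    simp [(hpos n).ne']
  obtain ⟨ζ, hζ, φ, hφ, hlim⟩ := (isCompact_sphere (0 : ℂ) 1).tendsto_subseq hmem
  refine ⟨ζ, mem_sphere_zero_iff_norm.1 hζ, w ∘ φ, fun n => hw _, fun n => ‖w (φ n)‖⁻¹,
    fun n => inv_pos.2 (hpos _), ?_, hlim⟩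
  have hinv : Tendsto (fun n => ‖w n‖⁻¹) atTop (nhds 0) :=
    squeeze_zero (fun n => (inv_pos.2 (hpos n)).le)
      (fun n => by simpa using inv_anti₀ (by positivity) (hnorm n).le)
      tendsto_one_div_add_atTop_nhds_zero_nat
  exact hinv.comp hφ.tendsto_atTop

theorem HarmonicFn.exists_eq_const_of_isBounded {u : ℂ → ℝ} (hu : HarmonicFn u)
    (hb : Bornology.IsBounded (range u)) : ∃ c, ∀ z, u z = c :=
  ⟨u 0, fun z => InnerProductSpace.bounded_harmonic_on_complex_plane_is_constant u
    hu.harmonicOnNhd_univ hb z 0⟩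

/-- **Corollary 2.3.** If `f = u + iv` is a nonconstant harmonic map then the set of asymptotic
directions of its range is a nonempty closed subset of the unit circle. -/
theorem asympDirs_of_nonconstant_harmonic_map
    (u v : ℂ → ℝ) (hu : HarmonicFn u) (hv : HarmonicFn v)
    (f : ℂ → ℂ) (hf : ∀ z, f z = (u z : ℂ) + (v z : ℂ) * Complex.I)
    (hnc : ¬ ∃ c : ℂ, ∀ z, f z = c) :
    (asympDirs (Set.range f)).Nonempty ∧ IsClosed (asympDirs (Set.range f)) ∧
      asympDirs (Set.range f) ⊆ Metric.sphere (0 : ℂ) 1 := by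
  refine ⟨asympDirs_nonempty_of_not_isBounded fun hb => hnc ?_, isClosed_asympDirs _,
    asympDirs_subset_sphere _⟩
  have hre : range u = re '' range f := by
    rw [← range_comp]; congr 1; ext z; simp [hf]
  have him : range v = im '' range f := by
    rw [← range_comp]; congr 1; ext z; simp [hf]
  obtain ⟨a, ha⟩ := hu.exists_eq_const_of_isBounded
    (hre ▸ reCLM.lipschitz.isBounded_image hb)
  obtain ⟨b, hb'⟩ := hv.exists_eq_const_of_isBounded
    (him ▸ imCLM.lipschitz.isBounded_image hb)
  exact ⟨a + b * I, fun z => by rw [hf, ha, hb']⟩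
end

section
/- If E ⊆ ∂𝔻 is a closed subset of the unit circle that contains no pair of antipodal points, then there exists α ∈ [0, 2π) such that the three points −i·e^{iα}, e^{iα}, i·e^{iα} all belong to ∂𝔻 \ E. -/
open Complex Metric Filter Set

/-- A closed set of complex numbers without antipodal pairs misses some antipodal pair of the
unit circle. -/
theorem exists_antipodal_notMem_of_isClosed {E : Set ℂ} (hclosed : IsClosed E)
    (hno : ¬ ∃ ζ : ℂ, ζ ∈ E ∧ -ζ ∈ E) :
    ∃ t : ℝ, Complex.exp (t * Complex.I) ∉ E ∧ -Complex.exp (t * Complex.I) ∉ E := by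
  by_contra! h
  let f : ℝ → ℂ := fun t => Complex.exp (t * Complex.I)
  have hf : Continuous f := by fun_prop
  have hcompl : (f ⁻¹' E)ᶜ = (fun t => -f t) ⁻¹' E := by
    ext t
    exact ⟨h t, fun hn hp => hno ⟨f t, hp, hn⟩⟩
  have hopen : IsOpen (f ⁻¹' E) := by
    rw [← isClosed_compl_iff, hcompl]
    exact hclosed.preimage hf.neg
  have h0 : f 0 = 1 := by simp [f]
  have hpi : f Real.pi = -1 := Complex.exp_pi_mul_I
  rcases isClopen_iff.mp ⟨hclosed.preimage hf, hopen⟩ with he | hu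
  · have h1 : (1 : ℂ) ∉ E := fun hm => he.subset (show f 0 ∈ E from h0 ▸ hm)
    have h2 : (-1 : ℂ) ∉ E := fun hm => he.subset (show f Real.pi ∈ E from hpi ▸ hm)
    exact h2 (h0 ▸ h 0 (show f 0 ∉ E from h0 ▸ h1))
  · have h1 : f 0 ∈ E := hu.superset (Set.mem_univ 0)
    have h2 : f Real.pi ∈ E := hu.superset (Set.mem_univ Real.pi)
    exact hno ⟨1, h0 ▸ h1, hpi ▸ h2⟩

/-- Every `e^{it}` with `t` real has an argument in `[0, 2π)`. -/
theorem exists_mem_Ico_exp_mul_I_eq (t : ℝ) :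
    ∃ α : ℝ, 0 ≤ α ∧ α < 2 * Real.pi ∧
      Complex.exp (α * Complex.I) = Complex.exp (t * Complex.I) := by
  obtain ⟨α, hα, heq⟩ := Function.Periodic.exists_mem_Ico₀
    (f := fun s : ℝ => Complex.exp (s * Complex.I)) (c := 2 * Real.pi)
    (fun s => by
      have := Complex.exp_mul_I_periodic s
      push_cast
      exact this) Real.two_pi_pos t
  exact ⟨α, hα.1, hα.2, heq.symm⟩

/-- **Lemma 2.6.** If `E` is a closed subset of the unit circle containing no pair of antipodal
points, then there is `α ∈ [0, 2π)` with `-i·e^{iα}`, `e^{iα}`, `i·e^{iα}` all outside `E`. -/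
theorem closed_no_antipodal_three_directions
    (E : Set ℂ) (hE : E ⊆ Metric.sphere (0 : ℂ) 1) (hclosed : IsClosed E)
    (hno : ¬ ∃ ζ : ℂ, ζ ∈ E ∧ -ζ ∈ E) :
    ∃ α : ℝ, 0 ≤ α ∧ α < 2 * Real.pi ∧
      -Complex.I * Complex.exp (α * Complex.I) ∉ E ∧
      Complex.exp (α * Complex.I) ∉ E ∧
      Complex.I * Complex.exp (α * Complex.I) ∉ E := by
  obtain ⟨t, hp, hn⟩ := exists_antipodal_notMem_of_isClosed hclosed hno
  by_cases hI : Complex.I * Complex.exp (t * Complex.I) ∈ E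
  · obtain ⟨α, h0, h2, heq⟩ := exists_mem_Ico_exp_mul_I_eq (t - Real.pi / 2)
    have hrot : Complex.exp (α * Complex.I) = -(Complex.I * Complex.exp (t * Complex.I)) := by
      rw [heq]
      push_cast
      rw [sub_mul, Complex.exp_sub, Complex.exp_pi_div_two_mul_I, Complex.div_I]
      ring
    refine ⟨α, h0, h2, ?_, ?_, ?_⟩ <;> rw [hrot]
    · simpa [← mul_assoc] using hn
    · exact fun hm => hno ⟨_, hI, hm⟩
    · simpa [← mul_assoc] using hp
  · obtain ⟨α, h0, h2, heq⟩ := exists_mem_Ico_exp_mul_I_eq (t + Real.pi / 2)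
    have hrot : Complex.exp (α * Complex.I) = Complex.I * Complex.exp (t * Complex.I) := by
      rw [heq]
      push_cast
      rw [add_mul, Complex.exp_add, Complex.exp_pi_div_two_mul_I, mul_comm]
    refine ⟨α, h0, h2, ?_, ?_, ?_⟩ <;> rw [hrot]
    · simpa [← mul_assoc] using hp
    · exact hI
    · simpa [← mul_assoc] using hn
end

section
/- Let f = u + iv : ℂ → ℂ be a harmonic map such that D(R_f) contains no pair of antipodal points. Then there exist ξ ∈ ∂𝔻, 0 < φ < π/2 and ρ > 0 such that R_f ⊆ D̄(0, ρ) ∪ ( ℂ \ ( C_{iξ,φ} ∪ C⁺_{ξ,φ} ) ); that is, outside some disc centered at the origin, R_f does not intersect the union of a whole cone and a half cone with vertex at the origin and orthogonal axes. -/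
open Complex Metric Filter Set

/-- Asymptotic directions are the unit vectors adherent to the radial projections of the far
parts of the set. -/
theorem asympDirs_eq_sphere_inter_iInter_closure (R : Set ℂ) :
    asympDirs R = sphere 0 1 ∩
      ⋂ ρ : ℝ, closure ((fun w : ℂ => ‖w‖⁻¹ • w) '' {w ∈ R | ρ < ‖w‖}) := by
  ext ζ
  simp only [asympDirs, mem_ofPred_eq, mem_inter_iff, mem_sphere_zero_iff_norm, mem_iInter]
  refine and_congr_right fun hζ => ⟨?_, fun h => ?_⟩
  · rintro ⟨w, hw, ε, hε, hε0, hlim⟩ ρ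
    have hnorm : Tendsto (fun n => ε n * ‖w n‖) atTop (nhds 1) := by
      simpa [hζ, abs_of_pos (hε _)] using hlim.norm
    have hdir : Tendsto (fun n => ‖w n‖⁻¹ • w n) atTop (nhds ζ) := by
      have h := (hnorm.inv₀ one_ne_zero).smul hlim
      rw [inv_one, one_smul] at h
      refine h.congr fun n => ?_
      have := (hε n).ne'
      rw [← real_smul, smul_smul, mul_inv, mul_right_comm, inv_mul_cancel₀ this, one_mul]
    refine mem_closure_of_tendsto hdir ?_
    have hsmall : Tendsto (fun n => ε n * ρ) atTop (nhds 0) := by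
      simpa using hε0.mul_const ρ
    filter_upwards [hsmall.eventually_lt hnorm one_pos] with n hn
    exact ⟨w n, ⟨hw n, lt_of_mul_lt_mul_left hn (hε n).le⟩, rfl⟩
  · have hex : ∀ n : ℕ, ∃ w ∈ R, (n : ℝ) < ‖w‖ ∧ dist ζ (‖w‖⁻¹ • w) < 1 / ((n : ℝ) + 1) := by
      intro n
      obtain ⟨_, ⟨w, ⟨hwR, hwn⟩, rfl⟩, hd⟩ :=
        Metric.mem_closure_iff.1 (h n) _ (Nat.one_div_pos_of_nat (n := n))
      exact ⟨w, hwR, hwn, hd⟩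
    choose w hwR hwn hd using hex
    refine ⟨w, hwR, fun n => ‖w n‖⁻¹, fun n => inv_pos.2 ((Nat.cast_nonneg n).trans_lt (hwn n)),
      ?_, ?_⟩
    · exact tendsto_inv_atTop_zero.comp
        (tendsto_atTop_mono (fun n => (hwn n).le) tendsto_natCast_atTop_atTop)
    · rw [tendsto_iff_dist_tendsto_zero]
      refine squeeze_zero (fun _ => dist_nonneg) (fun n => ?_)
        (tendsto_one_div_add_atTop_nhds_zero_nat (𝕜 := ℝ))
      rw [← real_smul, dist_comm]
      exact (hd n).le

/-- A closed subset of the unit circle without antipodal pairs misses some antipodal pair. -/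
theorem exists_unit_notMem_neg_notMem {D : Set ℂ} (hD : IsClosed D)
    (hno : ¬ ∃ ζ : ℂ, ζ ∈ D ∧ -ζ ∈ D) : ∃ η : ℂ, ‖η‖ = 1 ∧ η ∉ D ∧ -η ∉ D := by
  by_contra! hcover
  have hneg : IsClosed (-D) := hD.neg
  have hconn : IsPreconnected (sphere (0 : ℂ) 1) :=
    isPreconnected_sphere (by simp [Complex.rank_real_complex]) 0 1
  have hsub : sphere (0 : ℂ) 1 ⊆ D ∪ -D := fun η hη => by
    by_cases h : η ∈ D
    · exact Or.inl h
    · exact Or.inr (hcover η (mem_sphere_zero_iff_norm.1 hη) h)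
  have hmeet : (sphere (0 : ℂ) 1 ∩ D).Nonempty ∧ (sphere (0 : ℂ) 1 ∩ -D).Nonempty := by
    have h1 : ‖(1 : ℂ)‖ = 1 := norm_one
    by_cases h : (1 : ℂ) ∈ D
    · exact ⟨⟨1, by simp, h⟩, ⟨-1, by simp, by simpa using h⟩⟩
    · exact ⟨⟨-1, by simp, hcover 1 h1 h⟩, ⟨1, by simp, hcover 1 h1 h⟩⟩
  obtain ⟨ζ, -, hζ, hnegζ⟩ :=
    isPreconnected_closed_iff.1 hconn D (-D) hD hneg hsub hmeet.1 hmeet.2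
  exact hno ⟨ζ, hζ, hnegζ⟩

/-- Around a direction that is not asymptotic there is a half cone in which the set is bounded. -/
theorem exists_halfCone_bounded {R : Set ℂ} {α : ℝ}
    (h : exp (α * I) ∉ asympDirs R) :
    ∃ φ ρ : ℝ, 0 < φ ∧ ∀ t θ : ℝ, 0 < t → |θ - α| ≤ φ → (t : ℂ) * exp (θ * I) ∈ R → t ≤ ρ := by
  rw [asympDirs_eq_sphere_inter_iInter_closure] at h
  simp only [mem_inter_iff, mem_sphere_zero_iff_norm, norm_exp_ofReal_mul_I, true_and,
    mem_iInter, not_forall] at h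
  obtain ⟨ρ, hρ⟩ := h
  rw [Metric.mem_closure_iff] at hρ
  push Not at hρ
  obtain ⟨δ, hδ, hfar⟩ := hρ
  refine ⟨δ / 2, ρ, half_pos hδ, fun t θ ht hθ hR => ?_⟩
  by_contra! hlt
  have hnorm : ‖(t : ℂ) * exp (θ * I)‖ = t := by
    rw [norm_mul, norm_exp_ofReal_mul_I, mul_one, norm_real, Real.norm_of_nonneg ht.le]
  have hle := hfar _ ⟨_, ⟨hR, hnorm.symm ▸ hlt⟩, rfl⟩
  have hproj : ‖(t : ℂ) * exp (θ * I)‖⁻¹ • ((t : ℂ) * exp (θ * I)) = exp (θ * I) := by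
    rw [hnorm, ← real_smul, smul_smul, inv_mul_cancel₀ ht.ne', one_smul]
  have hdist : dist (exp (α * I)) (exp (θ * I)) ≤ |θ - α| := by
    have hfactor : exp (θ * I) - exp (α * I) = exp (α * I) * (exp (I * (θ - α : ℝ)) - 1) := by
      rw [mul_sub, ← Complex.exp_add, mul_one]
      push_cast
      ring_nf
    rw [dist_comm, dist_eq_norm, hfactor, norm_mul, norm_exp_ofReal_mul_I, one_mul,
      ← Real.norm_eq_abs]
    exact Real.norm_exp_I_mul_ofReal_sub_one_le
  simp only [hproj] at hle
  linarith

/-- If `±i·e^{iα}` and `e^{iα}` are not asymptotic directions of `R`, then far from the origin `R`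
avoids a whole cone about `i·e^{iα}` and a half cone about `e^{iα}`. -/
theorem exists_cones_avoided {R : Set ℂ} {α : ℝ} (h : exp (α * I) ∉ asympDirs R)
    (hI : exp ((α + Real.pi / 2 : ℝ) * I) ∉ asympDirs R)
    (hI' : -exp ((α + Real.pi / 2 : ℝ) * I) ∉ asympDirs R) :
    ∃ φ ρ : ℝ, 0 < φ ∧ φ < Real.pi / 2 ∧ 0 < ρ ∧
      R ⊆ closedBall (0 : ℂ) ρ ∪
        ({w : ℂ | ∃ t θ : ℝ, |θ - (α + Real.pi / 2)| ≤ φ ∧ w = (t : ℂ) * exp (θ * I)} ∪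
         {w : ℂ | ∃ t θ : ℝ, 0 ≤ t ∧ |θ - α| ≤ φ ∧ w = (t : ℂ) * exp (θ * I)})ᶜ := by
  have hshift (x : ℝ) : exp ((x + Real.pi : ℝ) * I) = -exp (x * I) := by
    rw [ofReal_add, add_mul, Complex.exp_add, exp_pi_mul_I, mul_neg_one]
  rw [← hshift] at hI'
  obtain ⟨φ₁, ρ₁, hφ₁, h₁⟩ := exists_halfCone_bounded h
  obtain ⟨φ₂, ρ₂, hφ₂, h₂⟩ := exists_halfCone_bounded hI
  obtain ⟨φ₃, ρ₃, hφ₃, h₃⟩ := exists_halfCone_bounded hI'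
  obtain ⟨φ, hφ, hφ_lt⟩ : ∃ φ, 0 < φ ∧ φ < min (min φ₁ φ₂) (min φ₃ (Real.pi / 2)) :=
    exists_between (by positivity)
  obtain ⟨⟨hφ_lt₁, hφ_lt₂⟩, hφ_lt₃, hφ_lt_pi⟩ : (φ < φ₁ ∧ φ < φ₂) ∧ φ < φ₃ ∧ φ < Real.pi / 2 := by
    simpa only [lt_min_iff] using hφ_lt
  refine ⟨φ, max 1 (max ρ₁ (max ρ₂ ρ₃)), hφ, hφ_lt_pi, by positivity, fun w hw => ?_⟩
  rw [mem_union, or_iff_not_imp_right, notMem_compl_iff, mem_closedBall_zero_iff]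
  rintro (⟨t, θ, hθ, rfl⟩ | ⟨t, θ, ht, hθ, rfl⟩) <;>
    rw [norm_mul, norm_exp_ofReal_mul_I, mul_one, norm_real, Real.norm_eq_abs]
  · rcases lt_trichotomy t 0 with ht | rfl | ht
    · have hle := h₃ (-t) (θ + Real.pi) (neg_pos.2 ht)
        (by rw [add_sub_add_right_eq_sub]; exact hθ.trans hφ_lt₃.le)
        (by rw [hshift, ofReal_neg, neg_mul_neg]; exact hw)
      rw [abs_of_neg ht]
      simp [hle]
    · simp
    · have hle := h₂ t θ ht (hθ.trans hφ_lt₂.le) hw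
      rw [abs_of_pos ht]
      simp [hle]
  · rcases ht.eq_or_lt with rfl | ht
    · simp
    · have hle := h₁ t θ ht (hθ.trans hφ_lt₁.le) hw
      rw [abs_of_pos ht]
      simp [hle]

/-- **Lemma 2.7.** If `f = u + iv` is a harmonic map whose set of asymptotic directions contains
no pair of antipodal points, then there are a direction `ξ = e^{iα}`, an aperture `0 < φ < π/2`
and `ρ > 0` such that, outside the closed disc of radius `ρ`, the range of `f` avoids the union
of the whole cone with axis `i·ξ = e^{i(α + π/2)}` and the half cone with axis `ξ`, both of
aperture `2φ` and vertex at the origin. -/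
theorem range_avoids_cones
    (u v : ℂ → ℝ) (hu : HarmonicFn u) (hv : HarmonicFn v)
    (f : ℂ → ℂ) (hf : ∀ z, f z = (u z : ℂ) + (v z : ℂ) * Complex.I)
    (hno : ¬ ∃ ζ : ℂ, ζ ∈ asympDirs (Set.range f) ∧ -ζ ∈ asympDirs (Set.range f)) :
    ∃ α φ ρ : ℝ, 0 < φ ∧ φ < Real.pi / 2 ∧ 0 < ρ ∧
      Set.range f ⊆ Metric.closedBall (0 : ℂ) ρ ∪
        ({w : ℂ | ∃ t θ : ℝ, |θ - (α + Real.pi / 2)| ≤ φ ∧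
            w = (t : ℂ) * Complex.exp (θ * Complex.I)} ∪
         {w : ℂ | ∃ t θ : ℝ, 0 ≤ t ∧ |θ - α| ≤ φ ∧
            w = (t : ℂ) * Complex.exp (θ * Complex.I)})ᶜ := by
  obtain ⟨η, hη, hηD, hηD'⟩ := exists_unit_notMem_neg_notMem (isClosed_asympDirs (range f)) hno
  have hrot (x : ℝ) : exp ((x + Real.pi / 2 : ℝ) * I) = exp (x * I) * I := by
    push_cast
    rw [add_mul, Complex.exp_add, exp_pi_div_two_mul_I]
  obtain ⟨ξ, hξ, hξD, hI, hI'⟩ : ∃ ξ : ℂ, ‖ξ‖ = 1 ∧ ξ ∉ asympDirs (range f) ∧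
      ξ * I ∉ asympDirs (range f) ∧ -(ξ * I) ∉ asympDirs (range f) := by
    by_cases h : η * I ∈ asympDirs (range f)
    · exact ⟨-(η * I), by simp [hη], fun hneg => hno ⟨_, h, hneg⟩,
        by simpa [mul_assoc] using hηD, by simpa [mul_assoc] using hηD'⟩
    · exact ⟨η * I, by simp [hη], h,
        by simpa [mul_assoc] using hηD', by simpa [mul_assoc] using hηD⟩
  have hexp : exp (ξ.arg * I) = ξ := by simpa [hξ] using norm_mul_exp_arg_mul_I ξ
  exact ⟨ξ.arg, exists_cones_avoided (by rwa [hexp]) (by rwa [hrot, hexp]) (by rwa [hrot, hexp])⟩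
end

section
/- There exists an absolute constant C₀ > 0 with the following property: for every R > 0 and every function u that is harmonic in the open disc D(0, R), continuous on the closed disc D̄(0, R), and satisfies u(0) = 0, there exists a disc D(z, ρ) ⊆ D(0, R) such that u(z) = 0, M(u, 0, R/2) ≤ C₀·M(u, z, ρ), and M(u, z, ρ) ≤ C₀·M(u, z, ρ/2). -/
open Complex Metric Filter Set

theorem HarmonicOnSet.harmonicOnNhd {u : ℂ → ℝ} {s : Set ℂ} (hs : IsOpen s)
    (hu : HarmonicOnSet u s) : InnerProductSpace.HarmonicOnNhd u s := by
  intro x hx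
  refine ⟨hu.1.contDiffAt (hs.mem_nhds hx), ?_⟩
  filter_upwards [hs.mem_nhds hx] with y hy
  have h := hu.2 y hy
  rw [iteratedFDerivWithin_of_isOpen 2 hs hy] at h
  simpa [InnerProductSpace.laplacian_eq_iteratedFDeriv_complexPlane] using h

/-- **Harnack's inequality** at half the radius, comparing with the value at the center. -/
theorem InnerProductSpace.HarmonicOnNhd.apply_center_le {u : ℂ → ℝ} {c w : ℂ} {r : ℝ}
    (hr : 0 < r) (hu : HarmonicOnNhd u (closedBall c r)) (hpos : ∀ z ∈ closedBall c r, 0 ≤ u z)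
    (hw : ‖w - c‖ ≤ r / 2) : u c ≤ 3 * u w := by
  have hwb : w ∈ ball c r := by rw [mem_ball_iff_norm]; linarith
  have hcont : ContinuousOn u (sphere c |r|) :=
    hu.continuousOn.mono (by rw [abs_of_pos hr]; exact sphere_subset_closedBall)
  have hcenter := hu.circleAverage_re_herglotzRieszKernel_smul (mem_ball_self hr)
  have hpoint := hu.circleAverage_re_herglotzRieszKernel_smul hwb
  have hintegrable (v : ℂ) (hv : v ∈ ball c r) :
      CircleIntegrable ((re ∘ herglotzRieszKernel c v) • u) c r :=
    ContinuousOn.circleIntegrable'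
      ((continuous_re.comp_continuousOn (continuousOn_herglotzRieszKernel_sphere hv)).smul hcont)
  have hle : Real.circleAverage ((1 / 3 : ℝ) • ((re ∘ herglotzRieszKernel c c) • u)) c r ≤
      Real.circleAverage ((re ∘ herglotzRieszKernel c w) • u) c r := by
    refine Real.circleAverage_mono ((hintegrable c (mem_ball_self hr)).const_smul)
      (hintegrable w hwb) ?_
    intro x hx
    rw [abs_of_pos hr] at hx
    have hux := hpos x (sphere_subset_closedBall hx)
    have hc : (herglotzRieszKernel c c x).re ≤ 1 := by
      simpa [herglotzRieszKernel_def, hr.ne'] using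
        re_herglotzRieszKernel_le hx (mem_ball_self hr)
    have hk : 1 / 3 ≤ (herglotzRieszKernel c w x).re := by
      refine le_trans ?_ (le_re_herglotzRieszKernel hx hwb)
      rw [div_le_div_iff₀ (by norm_num) (by positivity)]
      linarith
    simp only [Pi.smul_apply, Pi.mul_apply, Function.comp_apply, smul_eq_mul]
    nlinarith [mul_le_mul_of_nonneg_right hc hux, mul_le_mul_of_nonneg_right hk hux]
  rw [Real.circleAverage_smul, hcenter, hpoint, smul_eq_mul] at hle
  linarith

theorem le_supOn {u : ℂ → ℝ} {z w : ℂ} {r : ℝ} (hu : ContinuousOn u (closedBall z r))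
    (hw : w ∈ closedBall z r) : u w ≤ supOn u z r :=
  le_csSup ((isCompact_closedBall z r).bddAbove_image hu) (mem_image_of_mem u hw)

theorem supOn_le {u : ℂ → ℝ} {z : ℂ} {r B : ℝ} (hr : 0 ≤ r)
    (h : ∀ w ∈ closedBall z r, u w ≤ B) : supOn u z r ≤ B :=
  csSup_le ((nonempty_closedBall.2 hr).image u) (forall_mem_image.2 h)

/-- A continuous function without zeros on a ball, positive at its center, is positive. -/
theorem pos_on_closedBall_of_ne_zero {u : ℂ → ℝ} {c : ℂ} {r : ℝ} (hr : 0 ≤ r)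
    (hu : ContinuousOn u (closedBall c r)) (hc : 0 < u c)
    (hne : ∀ z ∈ closedBall c r, u z ≠ 0) : ∀ z ∈ closedBall c r, 0 < u z := by
  intro z hz
  by_contra! hneg
  obtain ⟨y, hy, hy0⟩ := (convex_closedBall c r).isPreconnected.intermediate_value hz
    (mem_closedBall_self hr) hu ⟨hneg, hc.le⟩
  exact hne y hy hy0

/-- If a harmonic function is at most `γ` on the Whitney disc around each of its zeros, it is at
most a constant times `γ` on the Whitney discs of twice the radius. -/
theorem InnerProductSpace.HarmonicOnNhd.le_of_le_near_zeros {u : ℂ → ℝ} {R γ : ℝ}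
    (hu : HarmonicOnNhd u (ball 0 R)) (hγ : 0 ≤ γ)
    (hle : ∀ y ∈ ball (0 : ℂ) R, u y = 0 → ∀ w ∈ closedBall y ((R - ‖y‖) / 4), u w ≤ γ)
    {z w : ℂ} (hz : z ∈ ball 0 R) (hz0 : u z = 0)
    (hw : w ∈ closedBall z (2 * ((R - ‖z‖) / 4))) : u w ≤ 3 ^ 10 * γ := by
  rw [mem_ball_zero_iff] at hz
  rw [mem_closedBall_iff_norm] at hw
  set δ := (R - ‖z‖) / 4 with hδ
  have hδ0 : 0 < δ := by linarith
  let p : ℕ → ℂ := fun k ↦ z + ((k / 10 : ℝ) : ℂ) * (w - z)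
  have hstep (k : ℕ) : ‖p k - p (k + 1)‖ ≤ (2 * δ / 5) / 2 := by
    have : p k - p (k + 1) = ((-(1 / 10) : ℝ) : ℂ) * (w - z) := by
      simp only [p]; push_cast; ring
    rw [this, norm_mul, norm_real, Real.norm_eq_abs, abs_neg, abs_of_pos (by norm_num)]
    linarith
  have hnorm (k : ℕ) (hk : k ≤ 10) : ‖p k‖ ≤ R - 2 * δ := by
    have hk' : (k / 10 : ℝ) ≤ 1 := by
      rw [div_le_one (by norm_num)]; exact_mod_cast hk
    calc ‖p k‖ ≤ ‖z‖ + (k / 10 : ℝ) * ‖w - z‖ := by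
          refine (norm_add_le _ _).trans_eq ?_
          rw [norm_mul, norm_real, Real.norm_eq_abs, abs_of_nonneg (by positivity)]
      _ ≤ ‖z‖ + 1 * (2 * δ) := by gcongr
      _ = R - 2 * δ := by rw [hδ]; ring
  have hmain (k : ℕ) (hk : k ≤ 10) : u (p k) ≤ 3 ^ k * γ := by
    induction k with
    | zero => simpa [p, hz0] using hγ
    | succ k ih =>
      have hγk : γ ≤ 3 ^ (k + 1) * γ := le_mul_of_one_le_left hγ (one_le_pow₀ (by norm_num))
      have hsub : closedBall (p (k + 1)) (2 * δ / 5) ⊆ closedBall 0 (R - 8 * δ / 5) := by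
        refine closedBall_subset_closedBall' ?_
        rw [dist_zero_right]
        linarith [hnorm (k + 1) hk]
      have hsub' : closedBall (p (k + 1)) (2 * δ / 5) ⊆ ball 0 R :=
        hsub.trans (closedBall_subset_ball (by linarith))
      by_cases hneg : u (p (k + 1)) ≤ 0
      · exact hneg.trans (hγ.trans hγk)
      by_cases hzero : ∃ y ∈ closedBall (p (k + 1)) (2 * δ / 5), u y = 0
      · obtain ⟨y, hy, hy0⟩ := hzero
        refine (hle y (hsub' hy) hy0 _ ?_).trans hγk
        have hy' := hsub hy
        rw [mem_closedBall_zero_iff] at hy'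
        rw [mem_closedBall, dist_comm]
        exact (mem_closedBall.1 hy).trans (by linarith)
      · push Not at hneg hzero
        have hu' := hu.mono hsub'
        have hpos := pos_on_closedBall_of_ne_zero (by positivity) hu'.continuousOn hneg hzero
        calc u (p (k + 1)) ≤ 3 * u (p k) :=
              hu'.apply_center_le (by positivity) (fun y hy ↦ (hpos y hy).le) (hstep k)
          _ ≤ 3 * (3 ^ k * γ) := by gcongr; exact ih (by omega)
          _ = 3 ^ (k + 1) * γ := by ring
  simpa [p] using hmain 10 le_rfl

/-- **Lewis' Lemma (Lemma 3.1).** There is an absolute constant `C₀ > 0` such that for every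
`R > 0` and every `u` harmonic in `D(0,R)`, continuous on `D̄(0,R)` with `u(0) = 0`, there is
a disc `D(z,ρ) ⊆ D(0,R)` with `u(z) = 0`, `M(u,0,R/2) ≤ C₀·M(u,z,ρ)` and
`M(u,z,ρ) ≤ C₀·M(u,z,ρ/2)`. -/
theorem lewis_lemma :
    ∃ C₀ : ℝ, 0 < C₀ ∧ ∀ R : ℝ, 0 < R → ∀ u : ℂ → ℝ,
      HarmonicOnSet u (Metric.ball 0 R) → ContinuousOn u (Metric.closedBall 0 R) → u 0 = 0 →
      ∃ z : ℂ, ∃ ρ : ℝ, 0 < ρ ∧ Metric.ball z ρ ⊆ Metric.ball (0 : ℂ) R ∧ u z = 0 ∧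
        supOn u 0 (R / 2) ≤ C₀ * supOn u z ρ ∧ supOn u z ρ ≤ C₀ * supOn u z (ρ / 2) := by
  refine ⟨2 * 3 ^ 10, by norm_num, fun R hR u hharm hcont h0 ↦ ?_⟩
  have hu := hharm.harmonicOnNhd isOpen_ball
  have hdisc {z : ℂ} (hz : z ∈ ball 0 R) {t : ℝ} (ht : t ≤ R - ‖z‖) :
      closedBall z t ⊆ closedBall 0 R := by
    refine closedBall_subset_closedBall' ?_
    rw [dist_zero_right]
    linarith
  have hrad {z : ℂ} (hz : z ∈ ball 0 R) : 0 < (R - ‖z‖) / 4 := by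
    rw [mem_ball_zero_iff] at hz
    linarith
  let S : Set ℝ := (fun z ↦ supOn u z ((R - ‖z‖) / 4)) '' {z | z ∈ ball 0 R ∧ u z = 0}
  have hbdd : BddAbove S := by
    refine ⟨supOn u 0 R, ?_⟩
    rintro _ ⟨z, ⟨hz, -⟩, rfl⟩
    have := hrad hz
    exact supOn_le this.le fun w hw ↦ le_supOn hcont (hdisc hz (by linarith) hw)
  have hle (y : ℂ) (hy : y ∈ ball 0 R) (hy0 : u y = 0) (w : ℂ)
      (hw : w ∈ closedBall y ((R - ‖y‖) / 4)) : u w ≤ sSup S := by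
    have := hrad hy
    exact (le_supOn (hcont.mono (hdisc hy (by linarith))) hw).trans
      (le_csSup hbdd ⟨y, ⟨hy, hy0⟩, rfl⟩)
  have h0R : (0 : ℂ) ∈ ball 0 R := mem_ball_self hR
  have hγ : 0 ≤ sSup S := by
    simpa [h0] using hle 0 h0R h0 0 (mem_closedBall_self (hrad h0R).le)
  have hdouble {z : ℂ} (hz : z ∈ ball 0 R) (hz0 : u z = 0) :
      supOn u z (2 * ((R - ‖z‖) / 4)) ≤ 3 ^ 10 * sSup S :=
    supOn_le (by linarith [hrad hz]) fun w hw ↦ hu.le_of_le_near_zeros hγ hle hz hz0 hw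
  obtain ⟨a, ha, ha0, haγ⟩ : ∃ a ∈ ball (0 : ℂ) R, u a = 0 ∧
      sSup S ≤ 2 * supOn u a ((R - ‖a‖) / 4) := by
    rcases hγ.eq_or_lt with hγ0 | hγ0
    · have := hrad h0R
      refine ⟨0, h0R, h0, ?_⟩
      rw [← hγ0]
      have := le_supOn (hcont.mono (hdisc h0R (by linarith))) (mem_closedBall_self this.le)
      linarith
    · obtain ⟨_, ⟨a, ⟨ha, ha0⟩, rfl⟩, hlt⟩ :=
        exists_lt_of_lt_csSup (⟨_, 0, ⟨h0R, h0⟩, rfl⟩ : S.Nonempty) (half_lt_self hγ0)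
      exact ⟨a, ha, ha0, by linarith⟩
  have hδ := hrad ha
  have hmono : supOn u a ((R - ‖a‖) / 4) ≤ supOn u a (2 * ((R - ‖a‖) / 4)) :=
    supOn_le hδ.le fun w hw ↦ le_supOn (hcont.mono (hdisc ha (by linarith)))
      (closedBall_subset_closedBall (by linarith) hw)
  refine ⟨a, 2 * ((R - ‖a‖) / 4), by linarith, ?_, ha0, ?_, ?_⟩
  · refine ball_subset_ball' ?_
    rw [dist_zero_right]
    linarith
  · have h := hdouble h0R h0
    rw [norm_zero, show 2 * ((R - 0) / 4) = R / 2 by ring] at h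
    linarith
  · rw [mul_div_cancel_left₀ _ (two_ne_zero' ℝ)]
    linarith [hdouble ha ha0]
end
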